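/- arXiv:1912.06909 — 3 statements merged into one kernel-verified Lean document; each statement's English description precedes it below -/
import Mathlib

section
/- For every preference profile P that is single-peaked with respect to ≺, the crawler from random endowments equals the core from random endowments: for every allocation x, the number of endowment profiles ω with CR(P,ω) = x equals the number of endowment profiles ω with TTC^ω(P) = x. -/
/- Preferences are given by rank functions: `rk i o` is agent `i`'s rank of object `o`
(lower rank = more preferred), so `o P_i o'` iff `rk i o < rk i o'`. -/

/-- Find the smallest index `t` such that the `t`-th agent prefers the `t`-th object
to the `(t+1)`-st object; the last index always qualifies. -/
def findIdx2 {n : ℕ} (rk : Fin n → Fin n → Fin n) : List (Fin n) → List (Fin n) → ℕ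
  | a :: as, o1 :: o2 :: os =>
      if rk a o1 < rk a o2 then 0 else findIdx2 rk as (o2 :: os) + 1
  | _, _ => 0

/-- One run of the (ascending) crawler: `agents` is the list of remaining agents in the
order of their current ownership, `objects` the list of remaining objects in increasing
`≺`-order (the `t`-th agent currently owns the `t`-th object). -/
def crawlAux {n : ℕ} (rk : Fin n → Fin n → Fin n) :
    ℕ → List (Fin n) → List (Fin n) → List (Fin n × Fin n)
  | 0, _, _ => []
  | fuel + 1, agents, objects =>
    match agents, objects with
    | a0 :: _, o0 :: _ =>
      let t := findIdx2 rk agents objects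
      let a := agents.getD t a0
      let ostar := (objects.argmin (rk a)).getD o0
      (a, ostar) :: crawlAux rk fuel (agents.eraseIdx t) (objects.erase ostar)
    | _, _ => []

/-- Agents listed in increasing order of their endowments. -/
def ownersList {n : ℕ} (ω : Fin n → Fin n) : List (Fin n) :=
  (List.finRange n).filterMap fun o => (List.finRange n).find? fun a => ω a == o

/-- The (ascending) crawler allocation. -/
def CRfun {n : ℕ} (rk : Fin n → Fin n → Fin n) (ω : Fin n → Fin n) (i : Fin n) : Fin n :=
  ((crawlAux rk n (ownersList ω) (List.finRange n)).lookup i).getD (ω i)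

/-- The descending crawler: the mirror image of the ascending crawler, obtained by
reversing the order `≺` on objects. -/
def DCRfun {n : ℕ} (rk : Fin n → Fin n → Fin n) (ω : Fin n → Fin n) (i : Fin n) : Fin n :=
  Fin.rev (CRfun (fun j o => rk j o.rev) (fun j => (ω j).rev) i)

/-- Sequential priority: agents in the given list pick, in order, their most
preferred remaining object. -/
def SPAux {n : ℕ} (rk : Fin n → Fin n → Fin n) :
    List (Fin n) → List (Fin n) → List (Fin n × Fin n)
  | [], _ => []
  | _ :: _, [] => []
  | a :: as, o0 :: os =>
      let o := ((o0 :: os).argmin (rk a)).getD o0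
      (a, o) :: SPAux rk as ((o0 :: os).erase o)

/-- The sequential priority rule induced by the order `f` (agent `f k` has priority `k`). -/
def SPfun {n : ℕ} (rk : Fin n → Fin n → Fin n) (f : Fin n → Fin n) (i : Fin n) : Fin n :=
  ((SPAux rk ((List.finRange n).map f) (List.finRange n)).lookup i).getD i

/-- Top trading cycles: `own` maps each remaining object to its (initial) owner. -/
def TTCAux {n : ℕ} (rk : Fin n → Fin n → Fin n) :
    ℕ → List (Fin n) → List (Fin n) → (Fin n → Fin n) → List (Fin n × Fin n)
  | 0, _, _, _ => []
  | fuel + 1, agents, objects, own =>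
    match agents with
    | [] => []
    | a0 :: _ =>
      let top : Fin n → Fin n := fun a => (objects.argmin (rk a)).getD a0
      let ptr : Fin n → Fin n := fun a => own (top a)
      let onCyc : Fin n → Bool := fun a =>
        (List.range agents.length).any fun k => ptr^[k + 1] a == a
      let cyc := agents.filter onCyc
      let assigned := cyc.map top
      (cyc.map fun a => (a, top a)) ++
        TTCAux rk fuel (agents.filter fun a => !onCyc a)
          (objects.filter fun o => !(assigned.contains o)) own

/-- The top trading cycles allocation from endowments `ω`. -/
def TTCfun {n : ℕ} (rk : Fin n → Fin n → Fin n) (ω : Equiv.Perm (Fin n)) (i : Fin n) : Fin n :=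
  ((TTCAux rk n (List.finRange n) (List.finRange n) ω.symm).lookup i).getD (ω i)

/-- A profile of strict preferences (given as rank permutations) is single-peaked
with respect to the order on `Fin n`. -/
def SinglePeaked {n : ℕ} (P : Fin n → Equiv.Perm (Fin n)) : Prop :=
  ∀ i : Fin n, ∃ p : Fin n, ∀ o o' : Fin n,
    ((o' < o ∧ o ≤ p) ∨ (p ≤ o ∧ o < o')) → P i o < P i o'

/-- Pareto efficiency of an allocation `x` at the profile `P`. -/
def ParetoEfficient {n : ℕ} (P : Fin n → Equiv.Perm (Fin n)) (x : Fin n → Fin n) : Prop :=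
  ¬ ∃ y : Equiv.Perm (Fin n),
      (∀ i, P i (y i) ≤ P i (x i)) ∧ ∃ j, P j (y j) < P j (x j)

section

variable {n : ℕ}

/-- `o` is the most preferred object of agent `a` among `O`. -/
def IsBest (rk : Fin n → Fin n → Fin n) (a : Fin n) (O : List (Fin n)) (o : Fin n) : Prop :=
  o ∈ O ∧ ∀ o' ∈ O, rk a o ≤ rk a o'

/-- Agent `a`, when owning the `k`-th object of `O`, does not want to move right. -/
def Stops (rk : Fin n → Fin n → Fin n) (a : Fin n) (O : List (Fin n)) (k : ℕ) : Prop :=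
  ∀ u v, O[k]? = some u → O[k + 1]? = some v → rk a u < rk a v

/-- Every agent in `A` wants to move right. -/
def Passes (rk : Fin n → Fin n → Fin n) (A O : List (Fin n)) : Prop :=
  ∀ i b, A[i]? = some b → ¬ Stops rk b O i

/-- Every agent gets, in the run of the crawler, the object prescribed by `x`. -/
def CrawlsTo (rk : Fin n → Fin n → Fin n) (x : Fin n → Fin n) (w O : List (Fin n)) : Prop :=
  ∀ p ∈ crawlAux rk w.length w O, x p.1 = p.2

/-- Each preference is unimodal along the order of the objects. -/
def Unimodal (rk : Fin n → Fin n → Fin n) : Prop :=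
  ∀ a u v w, u < v → v < w → rk a v < rk a u ∨ rk a v < rk a w

lemma SinglePeaked.unimodal {P : Fin n → Equiv.Perm (Fin n)} (hP : SinglePeaked P) :
    Unimodal fun j => ⇑(P j) := by
  intro a u v w huv hvw
  obtain ⟨p, hp⟩ := hP a
  rcases le_total v p with h | h
  · exact Or.inl (hp v u (Or.inl ⟨huv, h⟩))
  · exact Or.inr (hp v w (Or.inr ⟨h, hvw⟩))

section Crawler

variable {rk : Fin n → Fin n → Fin n} {x : Fin n → Fin n}

lemma exists_isBest (a : Fin n) {O : List (Fin n)} (hO : O ≠ []) : ∃ o, IsBest rk a O o := by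
  rcases hm : O.argmin (rk a) with _ | m
  · exact absurd (List.argmin_eq_none.1 hm) hO
  · exact ⟨m, List.argmin_mem hm, fun o' ho' => List.le_of_mem_argmin ho' hm⟩

lemma IsBest.unique (hinj : ∀ a, Function.Injective (rk a)) {a : Fin n} {O : List (Fin n)}
    {o o' : Fin n} (h : IsBest rk a O o) (h' : IsBest rk a O o') : o = o' :=
  hinj a (le_antisymm (h.2 _ h'.1) (h'.2 _ h.1))

lemma IsBest.argmin_eq (hinj : ∀ a, Function.Injective (rk a)) {a : Fin n} {O : List (Fin n)}
    {o : Fin n} (h : IsBest rk a O o) : O.argmin (rk a) = some o := by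
  rcases hm : O.argmin (rk a) with _ | m
  · rw [List.argmin_eq_none] at hm
    simp [hm, IsBest] at h
  · have hm' : m ∈ O.argmin (rk a) := hm
    congr 1
    exact IsBest.unique hinj ⟨List.argmin_mem hm', fun o' ho' => List.le_of_mem_argmin ho' hm'⟩ h

lemma stops_iff_le (hinj : ∀ a, Function.Injective (rk a)) (huni : Unimodal rk) {a : Fin n}
    {O : List (Fin n)} (hO : O.Pairwise (· < ·)) {o : Fin n} (ho : IsBest rk a O o) {j k : ℕ}
    (hj : O[j]? = some o) (hk : k < O.length) : Stops rk a O k ↔ j ≤ k := by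
  have hlt : ∀ (i j : ℕ) (u v : Fin n), i < j → O[i]? = some u → O[j]? = some v → u < v := by
    intro i j u v hij hu hv
    obtain ⟨hi, rfl⟩ := List.getElem?_eq_some_iff.1 hu
    obtain ⟨hj, rfl⟩ := List.getElem?_eq_some_iff.1 hv
    exact List.pairwise_iff_getElem.1 hO i j hi hj hij
  have hmin : ∀ (i : ℕ) (u : Fin n), i ≠ j → O[i]? = some u → rk a o < rk a u := by
    intro i u hij hu
    refine lt_of_le_of_ne (ho.2 u (List.mem_of_getElem? hu)) fun h => ?_
    have := hinj a h
    subst this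
    rcases lt_or_gt_of_ne hij with h' | h'
    · exact lt_irrefl _ (hlt _ _ _ _ h' hu hj)
    · exact lt_irrefl _ (hlt _ _ _ _ h' hj hu)
  constructor
  · intro hs
    by_contra hlt'
    have hjl : j < O.length := (List.getElem?_eq_some_iff.1 hj).1
    have h1 := hs O[k] O[k + 1] (by simp) (by simp [show k + 1 < O.length by omega])
    rcases Nat.lt_or_ge (k + 1) j with h | h
    · have h2 := huni a O[k] O[k + 1] o (hlt k (k + 1) _ _ (by omega) (by simp) (by simp))
        (hlt (k + 1) j _ _ h (by simp) hj)
      have h3 := hmin (k + 1) O[k + 1] (by omega) (by simp)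
      rcases h2 with h2 | h2
      · exact lt_asymm h1 h2
      · exact lt_asymm h2 h3
    · have : j = k + 1 := by omega
      subst this
      have h3 := hmin k O[k] (by omega) (by simp)
      obtain ⟨_, rfl⟩ := List.getElem?_eq_some_iff.1 hj
      exact lt_asymm h1 h3
  · intro hjk u v hu hv
    rcases hjk.eq_or_lt with rfl | hjk
    · rw [hj] at hu
      cases hu
      exact hmin _ _ (by omega) hv
    · rcases huni a o u v (hlt _ _ _ _ hjk hj hu) (hlt _ _ _ _ (by omega) hu hv) with h | h
      · exact absurd h (lt_asymm (hmin k u (by omega) hu))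
      · exact h

lemma Passes.nil (O : List (Fin n)) : Passes rk [] O := by
  intro i b h
  simp at h

lemma Passes.concat {A O : List (Fin n)} {z : Fin n} (h : Passes rk A O)
    (hz : ¬ Stops rk z O A.length) : Passes rk (A ++ [z]) O := by
  intro i b hb
  rcases lt_trichotomy i A.length with hi | rfl | hi
  · rw [List.getElem?_append_left hi] at hb
    exact h i b hb
  · simp at hb
    rwa [← hb]
  · rw [List.getElem?_append_right hi.le, List.getElem?_eq_none (by grind)] at hb
    cases hb

lemma passes_or_exists_stops (A O : List (Fin n)) :
    Passes rk A O ∨ ∃ B b C, A = B ++ b :: C ∧ Passes rk B O ∧ Stops rk b O B.length := by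
  induction A using List.reverseRecOn with
  | nil => exact Or.inl (Passes.nil O)
  | append_singleton A z ih =>
    rcases ih with h | ⟨B, b, C, rfl, h⟩
    · by_cases hz : Stops rk z O A.length
      · exact Or.inr ⟨A, z, [], rfl, h, hz⟩
      · exact Or.inl (h.concat hz)
    · exact Or.inr ⟨B, b, C ++ [z], by simp, h⟩

lemma findIdx2_eq {A Z O : List (Fin n)} {a : Fin n} (hlen : O.length = (A ++ a :: Z).length)
    (hA : Passes rk A O) (ha : Stops rk a O A.length) :
    findIdx2 rk (A ++ a :: Z) O = A.length := by
  induction A generalizing O with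
  | nil =>
    rcases O with _ | ⟨u, _ | ⟨v, O⟩⟩
    · simp at hlen
    · simp [findIdx2]
    · have := ha u v rfl rfl
      simp [findIdx2, this]
  | cons b A ih =>
    rcases O with _ | ⟨u, _ | ⟨v, O⟩⟩
    · simp at hlen
    · simp at hlen
    · have hb : ¬ rk b u < rk b v := fun h => hA 0 b rfl fun u' v' hu' hv' => by
        simp at hu' hv'
        rwa [← hu', ← hv']
      simp only [List.cons_append, findIdx2, hb, if_false, List.length_cons]
      rw [ih (by simpa using hlen) (fun i c hc hs => hA (i + 1) c (by simpa using hc)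
        fun p q hp hq => hs p q (by simpa using hp) (by simpa using hq))
        fun p q hp hq => ha p q (by simpa using hp) (by simpa using hq)]

lemma crawlsTo_iff (hinj : ∀ a, Function.Injective (rk a)) {A Z O : List (Fin n)} {a o : Fin n}
    (hlen : O.length = (A ++ a :: Z).length) (hA : Passes rk A O) (ha : Stops rk a O A.length)
    (ho : IsBest rk a O o) :
    CrawlsTo rk x (A ++ a :: Z) O ↔ x a = o ∧ CrawlsTo rk x (A ++ Z) (O.erase o) := by
  have hc : crawlAux rk (A ++ a :: Z).length (A ++ a :: Z) O =
      (a, o) :: crawlAux rk (A ++ Z).length (A ++ Z) (O.erase o) := by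
    obtain ⟨c, w, hw⟩ : ∃ c w, A ++ a :: Z = c :: w := by cases A <;> simp
    obtain ⟨u, O', rfl⟩ : ∃ u O', O = u :: O' := by
      rcases O with _ | ⟨u, O'⟩
      · simp at hlen
      · exact ⟨u, O', rfl⟩
    have hl : (A ++ a :: Z).length = (A ++ Z).length + 1 := by grind
    have hf := findIdx2_eq hlen hA ha
    rw [hl]
    have hd : (A ++ a :: Z).getD A.length c = a := by simp
    have he : (A ++ a :: Z).eraseIdx A.length = A ++ Z := by
      rw [List.eraseIdx_append_of_length_le le_rfl]; simp
    rw [hw] at hf hd he ⊢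
    simp only [crawlAux, hf, hd, he, ho.argmin_eq hinj, Option.getD_some]
  rw [CrawlsTo, hc]
  simp [CrawlsTo]

lemma stops_erase {a o : Fin n} {O : List (Fin n)} (hO : O.Nodup) {q k : ℕ}
    (hq : O[q]? = some o) (hqk : q ≤ k) : Stops rk a (O.erase o) k ↔ Stops rk a O (k + 1) := by
  obtain ⟨hq', rfl⟩ := List.getElem?_eq_some_iff.1 hq
  rw [hO.erase_getElem]
  simp only [Stops, List.getElem?_eraseIdx, if_neg (show ¬ k < q by omega),
    if_neg (show ¬ k + 1 < q by omega)]

lemma stops_erase_of_lt {a o : Fin n} {O : List (Fin n)} (hO : O.Nodup) {q k : ℕ}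
    (hq : O[q]? = some o) (hqk : k + 1 < q) : Stops rk a (O.erase o) k ↔ Stops rk a O k := by
  obtain ⟨hq', rfl⟩ := List.getElem?_eq_some_iff.1 hq
  rw [hO.erase_getElem]
  simp only [Stops, List.getElem?_eraseIdx, if_pos (show k < q by omega),
    if_pos (show k + 1 < q by omega)]

lemma IsBest.erase {a o u : Fin n} {O : List (Fin n)} (h : IsBest rk a O o) (hu : o ≠ u) :
    IsBest rk a (O.erase u) o :=
  ⟨(List.mem_erase_of_ne hu).2 h.1, fun o' ho' => h.2 o' (List.mem_of_mem_erase ho')⟩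

lemma crawlsTo_swap (hinj : ∀ a, Function.Injective (rk a)) (huni : Unimodal rk)
    {A Z O : List (Fin n)} {a c : Fin n} (hO : O.Pairwise (· < ·))
    (hlen : O.length = (A ++ a :: c :: Z).length)
    (ha : Stops rk a O A.length) (hc : ¬ Stops rk c O A.length) :
    CrawlsTo rk x (A ++ a :: c :: Z) O ↔ CrawlsTo rk x (A ++ c :: a :: Z) O := by
  obtain ⟨m, hm⟩ : ∃ m, A.length = m := ⟨_, rfl⟩
  induction m using Nat.strong_induction_on generalizing A O with
  | _ m ih =>
  rcases passes_or_exists_stops (rk := rk) A O with hA | ⟨B, b, C, rfl, hB, hb⟩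
  · have hO0 : O ≠ [] := by rintro rfl; simp at hlen
    obtain ⟨o, ho⟩ := exists_isBest (rk := rk) a hO0
    obtain ⟨j, hj⟩ := List.mem_iff_getElem?.1 ho.1
    have hjA : j ≤ A.length := (stops_iff_le hinj huni hO ho hj (by simp [hlen])).1 ha
    have hlen' : O.length = ((A ++ [c]) ++ a :: Z).length := by simp [hlen]
    have hAc : Passes rk (A ++ [c]) O := hA.concat hc
    have ha' : Stops rk a O (A ++ [c]).length :=
      (stops_iff_le hinj huni hO ho hj (by simp [hlen])).2 (by grind)
    rw [crawlsTo_iff hinj hlen hA ha ho]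
    have := crawlsTo_iff (x := x) hinj hlen' hAc ha' ho
    simp only [List.append_assoc, List.singleton_append] at this
    rw [this]
  · have hO0 : O ≠ [] := by rintro rfl; simp at hlen
    obtain ⟨o, ho⟩ := exists_isBest (rk := rk) b hO0
    obtain ⟨q, hq⟩ := List.mem_iff_getElem?.1 ho.1
    have hqB : q ≤ B.length := (stops_iff_le hinj huni hO ho hq (by simp [hlen])).1 hb
    have h1 : ∀ W : List (Fin n), W.length = Z.length + 2 →
        (CrawlsTo rk x ((B ++ b :: C) ++ W) O ↔ x b = o ∧ CrawlsTo rk x ((B ++ C) ++ W) (O.erase o)) := by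
      intro W hW
      have := crawlsTo_iff (x := x) (Z := C ++ W) hinj (by simp [hlen, hW]) hB hb ho
      simpa using this
    rw [h1 (a :: c :: Z) rfl, h1 (c :: a :: Z) rfl]
    have hl : (B ++ b :: C).length = (B ++ C).length + 1 := by grind
    refine and_congr_right fun _ => ih (B ++ C).length (by omega) (hO.sublist List.erase_sublist)
      ?_ ?_ ?_ rfl
    · rw [List.length_erase_of_mem ho.1, hlen]; simp
    · rw [stops_erase hO.nodup hq (by grind), ← hl]; exact ha
    · rw [stops_erase hO.nodup hq (by grind), ← hl]; exact hc

lemma crawlsTo_delete (hinj : ∀ a, Function.Injective (rk a)) (huni : Unimodal rk)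
    {A Z O : List (Fin n)} {a o : Fin n} (hO : O.Pairwise (· < ·))
    (hlen : O.length = (A ++ a :: Z).length) (hoA : O[A.length]? = some o)
    (ho : IsBest rk a O o) :
    CrawlsTo rk x (A ++ a :: Z) O ↔ x a = o ∧ CrawlsTo rk x (A ++ Z) (O.erase o) := by
  obtain ⟨m, hm⟩ : ∃ m, A.length = m := ⟨_, rfl⟩
  induction m using Nat.strong_induction_on generalizing A O with
  | _ m ih =>
  rcases passes_or_exists_stops (rk := rk) A O with hA | ⟨B, b, C, rfl, hB, hb⟩
  · exact crawlsTo_iff hinj hlen hA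
      ((stops_iff_le hinj huni hO ho hoA (by simp [hlen])).2 le_rfl) ho
  · have hO0 : O ≠ [] := by rintro rfl; simp at hlen
    obtain ⟨p, hp⟩ := exists_isBest (rk := rk) b hO0
    obtain ⟨q, hq⟩ := List.mem_iff_getElem?.1 hp.1
    have hqB : q ≤ B.length := (stops_iff_le hinj huni hO hp hq (by simp [hlen])).1 hb
    have hl : (B ++ b :: C).length = (B ++ C).length + 1 := by grind
    have hnd : O.Nodup := hO.nodup
    have hop : o ≠ p := by
      rintro rfl
      obtain ⟨h1, h2⟩ := List.getElem?_eq_some_iff.1 hq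
      obtain ⟨h3, h4⟩ := List.getElem?_eq_some_iff.1 hoA
      have := (hnd.getElem_inj_iff (hi := h1) (hj := h3)).1 (h2.trans h4.symm)
      simp at this; omega
    have hoq : (O.erase p)[(B ++ C).length]? = some o := by
      obtain ⟨hq', rfl⟩ := List.getElem?_eq_some_iff.1 hq
      rw [hnd.erase_getElem, List.getElem?_eraseIdx, if_neg (by grind), ← hl]
      exact hoA
    have hq2 : (O.erase o)[q]? = some p := by
      obtain ⟨hq', rfl⟩ := List.getElem?_eq_some_iff.1 hoA
      rw [hnd.erase_getElem, List.getElem?_eraseIdx, if_pos (by grind)]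
      exact hq
    have hB' : Passes rk B (O.erase o) := by
      intro i d hd
      have hi : i < B.length := (List.getElem?_eq_some_iff.1 hd).1
      rw [stops_erase_of_lt hnd hoA (by grind)]
      exact hB i d hd
    have hl' : (O.erase o).length = (B ++ b :: (C ++ Z)).length := by
      rw [List.length_erase_of_mem ho.1, hlen]; simp; omega
    have hb' : Stops rk b (O.erase o) B.length :=
      (stops_iff_le hinj huni (hO.sublist List.erase_sublist) (hp.erase hop.symm) hq2
        (by rw [hl']; simp)).2 hqB
    have h1 := crawlsTo_iff (x := x) (Z := C ++ a :: Z) hinj (by simp [hlen]) hB hb hp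
    have h2 := crawlsTo_iff (x := x) hinj hl' hB' hb' (hp.erase hop.symm)
    have h3 := ih (B ++ C).length (by omega) (hO.sublist (List.erase_sublist (a := p)))
      (by rw [List.length_erase_of_mem hp.1, hlen]; simp) hoq (ho.erase hop) rfl
    rw [List.erase_comm] at h2
    simp only [List.append_assoc, List.cons_append] at h1 h2 h3 ⊢
    rw [h1, h2, h3]
    tauto

end Crawler

section CrawlerCount

open scoped Classical in
/-- The orders of the agents of `S` from which the crawler ends at the allocation `x`. -/
noncomputable def crawlWords (rk : Fin n → Fin n → Fin n) (x : Fin n → Fin n)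
    (S : Finset (Fin n)) (O : List (Fin n)) : Finset (List (Fin n)) :=
  S.toList.permutations.toFinset.filter fun w => CrawlsTo rk x w O

/-- Agent `a` likes his object at least as much as those of all the agents of `S`. -/
def Content (rk : Fin n → Fin n → Fin n) (x : Fin n → Fin n) (S : Finset (Fin n))
    (a : Fin n) : Prop :=
  ∀ b ∈ S, rk a (x a) ≤ rk a (x b)

/-- The transposition of the entries number `k` and `k + 1` of a list. -/
def swapAt (k : ℕ) (w : List (Fin n)) : List (Fin n) :=
  match w.drop k with
  | a :: c :: Z => w.take k ++ c :: a :: Z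
  | _ => w

variable {rk : Fin n → Fin n → Fin n} {x : Fin n → Fin n} {S : Finset (Fin n)}
  {O w : List (Fin n)}

lemma mem_crawlWords :
    w ∈ crawlWords rk x S O ↔ (w.Nodup ∧ w.toFinset = S) ∧ CrawlsTo rk x w O := by
  simp only [crawlWords, Finset.mem_filter, List.mem_toFinset, List.mem_permutations]
  refine and_congr_left fun _ => ⟨fun h => ⟨h.nodup_iff.2 S.nodup_toList, ?_⟩, ?_⟩
  · rw [List.toFinset_eq_of_perm _ _ h, Finset.toList_toFinset]
  · rintro ⟨h, rfl⟩
    exact (List.toFinset_toList h).symm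

lemma length_of_mem_crawlWords (hw : w ∈ crawlWords rk x S O) : w.length = S.card := by
  obtain ⟨⟨h, rfl⟩, -⟩ := mem_crawlWords.1 hw
  exact (List.toFinset_card_of_nodup h).symm

lemma exists_eq_append_of_getElem? {i : ℕ} {a : Fin n} (h : w[i]? = some a) :
    ∃ A Z, w = A ++ a :: Z ∧ A.length = i := by
  obtain ⟨hi, rfl⟩ := List.getElem?_eq_some_iff.1 h
  exact ⟨w.take i, w.drop (i + 1), by simp, by simp; omega⟩

lemma swapAt_append (A Z : List (Fin n)) (a c : Fin n) :
    swapAt A.length (A ++ a :: c :: Z) = A ++ c :: a :: Z := by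
  simp [swapAt]

lemma exists_eq_append_of_lt {k : ℕ} (h : k + 1 < w.length) :
    ∃ A Z a c, w = A ++ a :: c :: Z ∧ A.length = k := by
  exact ⟨w.take k, w.drop (k + 2), w[k], w[k + 1], by simp, by simp; omega⟩

/-- The agent number `i` of the list `w` would take its favourite when holding the object number `k`. -/
def StopsAt (rk : Fin n → Fin n → Fin n) (O w : List (Fin n)) (k i : ℕ) : Prop :=
  ∃ a, w[i]? = some a ∧ Stops rk a O k

/-- The best object of the agent number `i` of the list `w` is the object number `k`. -/
def BestAt (rk : Fin n → Fin n → Fin n) (O w : List (Fin n)) (k i : ℕ) : Prop :=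
  ∃ a o, w[i]? = some a ∧ O[k]? = some o ∧ IsBest rk a O o

lemma swapAt_mem (hinj : ∀ a, Function.Injective (rk a)) (huni : Unimodal rk)
    (hO : O.Pairwise (· < ·)) (hlen : O.length = S.card) {k : ℕ} (hk : k + 1 < O.length)
    (hw : w ∈ crawlWords rk x S O)
    (h : ¬ (StopsAt rk O w k k ↔ StopsAt rk O w k (k + 1))) :
    swapAt k w ∈ crawlWords rk x S O ∧ swapAt k (swapAt k w) = w ∧
      (StopsAt rk O (swapAt k w) k k ↔ StopsAt rk O w k (k + 1)) ∧
      (StopsAt rk O (swapAt k w) k (k + 1) ↔ StopsAt rk O w k k) := by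
  have hl := length_of_mem_crawlWords hw
  obtain ⟨A, Z, a, c, rfl, rfl⟩ := exists_eq_append_of_lt (w := w) (k := k) (by omega)
  rw [swapAt_append, swapAt_append]
  have e1 : StopsAt rk O (A ++ a :: c :: Z) A.length A.length ↔ Stops rk a O A.length := by
    simp [StopsAt]
  have e2 : StopsAt rk O (A ++ a :: c :: Z) A.length (A.length + 1) ↔ Stops rk c O A.length := by
    simp [StopsAt]
  have e3 : StopsAt rk O (A ++ c :: a :: Z) A.length A.length ↔ Stops rk c O A.length := by
    simp [StopsAt]
  have e4 : StopsAt rk O (A ++ c :: a :: Z) A.length (A.length + 1) ↔ Stops rk a O A.length := by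
    simp [StopsAt]
  rw [e1, e2] at h ⊢
  refine ⟨?_, rfl, e3, e4⟩
  rw [mem_crawlWords] at hw ⊢
  have hp : (A ++ c :: a :: Z).Perm (A ++ a :: c :: Z) := (List.Perm.swap _ _ _).append_left A
  refine ⟨⟨hp.nodup_iff.2 hw.1.1, by rw [List.toFinset_eq_of_perm _ _ hp, hw.1.2]⟩, ?_⟩
  by_cases ha : Stops rk a O A.length
  · exact (crawlsTo_swap hinj huni hO (by omega) ha (by tauto)).1 hw.2
  · exact (crawlsTo_swap hinj huni hO (by simp at hl ⊢; omega) (by tauto) ha).2 hw.2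

open scoped Classical in
lemma card_stopsAt_succ (hinj : ∀ a, Function.Injective (rk a)) (huni : Unimodal rk)
    (hO : O.Pairwise (· < ·)) (hlen : O.length = S.card) {k : ℕ} (hk : k + 1 < O.length) :
    ((crawlWords rk x S O).filter fun w => StopsAt rk O w k (k + 1)).card =
      ((crawlWords rk x S O).filter fun w => StopsAt rk O w k k).card := by
  have key : ∀ p q : List (Fin n) → Prop, ((crawlWords rk x S O).filter p).card =
      ((crawlWords rk x S O).filter fun w => p w ∧ q w).card +
        ((crawlWords rk x S O).filter fun w => p w ∧ ¬ q w).card := fun p q => by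
    rw [← Finset.filter_filter, ← Finset.filter_filter, Finset.card_filter_add_card_filter_not]
  rw [key _ fun w => StopsAt rk O w k k, key (fun w => StopsAt rk O w k k)
    fun w => StopsAt rk O w k (k + 1)]
  congr 1
  · congr 1
    exact Finset.filter_congr fun w _ => and_comm
  · refine Finset.card_nbij' (swapAt k) (swapAt k) ?_ ?_ ?_ ?_ <;> intro w hw <;>
      simp only [Finset.coe_filter, Set.mem_ofPred_eq] at hw ⊢ <;>
      have := swapAt_mem hinj huni hO hlen hk hw.1 (by tauto) <;> tauto

lemma stopsAt_iff (hinj : ∀ a, Function.Injective (rk a)) (huni : Unimodal rk)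
    (hO : O.Pairwise (· < ·)) {k i : ℕ} (hk : k < O.length) (hi : i < w.length) :
    StopsAt rk O w k i ↔ ∃ j ≤ k, BestAt rk O w j i := by
  have hO0 : O ≠ [] := by rintro rfl; simp at hk
  obtain ⟨o, ho⟩ := exists_isBest (rk := rk) w[i] hO0
  obtain ⟨j, hj⟩ := List.mem_iff_getElem?.1 ho.1
  have := stops_iff_le hinj huni hO ho hj hk
  simp only [StopsAt, BestAt, List.getElem?_eq_getElem hi, Option.some.injEq,
    exists_eq_left', this]
  refine ⟨fun h => ⟨j, h, _, o, rfl, hj, ho⟩, ?_⟩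
  rintro ⟨j', hj', _, o', rfl, ho', hb⟩
  obtain rfl := IsBest.unique hinj ho hb
  obtain ⟨h1, h2⟩ := List.getElem?_eq_some_iff.1 hj
  obtain ⟨h3, h4⟩ := List.getElem?_eq_some_iff.1 ho'
  have := (hO.nodup.getElem_inj_iff (hi := h1) (hj := h3)).1 (h2.trans h4.symm)
  omega

lemma BestAt.unique (hinj : ∀ a, Function.Injective (rk a)) (hO : O.Nodup) {j j' i : ℕ}
    (h : BestAt rk O w j i) (h' : BestAt rk O w j' i) : j = j' := by
  obtain ⟨a, o, h1, h2, h3⟩ := h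
  obtain ⟨a', o', h1', h2', h3'⟩ := h'
  obtain rfl : a = a' := by simpa [h1] using h1'
  obtain rfl := IsBest.unique hinj h3 h3'
  obtain ⟨h1, h2⟩ := List.getElem?_eq_some_iff.1 h2
  obtain ⟨h3, h4⟩ := List.getElem?_eq_some_iff.1 h2'
  exact (hO.getElem_inj_iff (hi := h1) (hj := h3)).1 (h2.trans h4.symm)

open scoped Classical in
lemma card_stopsAt (hinj : ∀ a, Function.Injective (rk a)) (huni : Unimodal rk)
    (hO : O.Pairwise (· < ·)) (hlen : O.length = S.card) {k : ℕ} (hk : k < O.length) :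
    ((crawlWords rk x S O).filter fun w => StopsAt rk O w k k).card =
      ∑ i ∈ Finset.range (k + 1), ((crawlWords rk x S O).filter fun w => BestAt rk O w i i).card := by
  induction k with
  | zero =>
    rw [Finset.sum_range_one]
    congr 1
    refine Finset.filter_congr fun w hw => ?_
    rw [stopsAt_iff hinj huni hO hk (by rw [length_of_mem_crawlWords hw]; omega)]
    simp
  | succ k ih =>
    rw [Finset.sum_range_succ, ← ih (by omega), ← card_stopsAt_succ hinj huni hO hlen hk,
      ← Finset.card_union_of_disjoint]
    · rw [← Finset.filter_or]
      congr 1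
      refine Finset.filter_congr fun w hw => ?_
      have hl : k + 1 < w.length := by rw [length_of_mem_crawlWords hw]; omega
      rw [stopsAt_iff hinj huni hO hk hl, stopsAt_iff hinj huni hO (by omega) hl]
      constructor
      · rintro ⟨j, hj, h⟩
        rcases hj.eq_or_lt with rfl | hj
        · exact Or.inr h
        · exact Or.inl ⟨j, by omega, h⟩
      · rintro (⟨j, hj, h⟩ | h)
        · exact ⟨j, by omega, h⟩
        · exact ⟨_, le_rfl, h⟩
    · refine Finset.disjoint_filter.2 fun w hw h1 h2 => ?_
      have hl : k + 1 < w.length := by rw [length_of_mem_crawlWords hw]; omega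
      rw [stopsAt_iff hinj huni hO (by omega) hl] at h1
      obtain ⟨j, hj, h⟩ := h1
      have := h.unique hinj hO.nodup h2
      omega

open scoped Classical in
lemma card_crawlWords_eq_sum_range (hinj : ∀ a, Function.Injective (rk a)) (huni : Unimodal rk)
    (hO : O.Pairwise (· < ·)) (hlen : O.length = S.card) (hO0 : O ≠ []) :
    (crawlWords rk x S O).card = ∑ i ∈ Finset.range O.length,
      ((crawlWords rk x S O).filter fun w => BestAt rk O w i i).card := by
  obtain ⟨k, hk⟩ : ∃ k, O.length = k + 1 :=
    Nat.exists_eq_succ_of_ne_zero (by simpa using hO0)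
  rw [hk, ← card_stopsAt hinj huni hO hlen (by omega), Finset.filter_true_of_mem]
  intro w hw
  have hl : k < w.length := by rw [length_of_mem_crawlWords hw]; omega
  refine ⟨w[k], by simp, fun u v _ hv => ?_⟩
  rw [List.getElem?_eq_none (by omega)] at hv
  cases hv

lemma isBest_iff_content (hOS : O.toFinset = S.image x) {a : Fin n} (ha : a ∈ S) :
    IsBest rk a O (x a) ↔ Content rk x S a := by
  have hmem : ∀ o, o ∈ O ↔ ∃ b ∈ S, x b = o := fun o => by
    rw [← List.mem_toFinset, hOS, Finset.mem_image]
  simp only [IsBest, Content, hmem]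
  refine ⟨fun h b hb => h.2 _ ⟨b, hb, rfl⟩, fun h => ⟨⟨a, ha, rfl⟩, ?_⟩⟩
  rintro _ ⟨b, hb, rfl⟩
  exact h b hb

lemma bestAt_append {A Z : List (Fin n)} {a : Fin n} {k : ℕ} :
    BestAt rk O (A ++ a :: Z) k A.length ↔ ∃ o, O[k]? = some o ∧ IsBest rk a O o := by
  simp [BestAt]

lemma mem_crawlWords_delete (hinj : ∀ a, Function.Injective (rk a)) (huni : Unimodal rk)
    (hO : O.Pairwise (· < ·)) (hlen : O.length = S.card) {A Z : List (Fin n)} {a b : Fin n}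
    (hb : b ∈ S) (hx : Function.Injective x) (hob : O[A.length]? = some (x b)) :
    (A ++ a :: Z ∈ crawlWords rk x S O ∧ BestAt rk O (A ++ a :: Z) A.length A.length) ↔
      a = b ∧ IsBest rk b O (x b) ∧ A ++ Z ∈ crawlWords rk x (S.erase b) (O.erase (x b)) := by
  rw [bestAt_append]
  simp only [hob, Option.some.injEq, exists_eq_left']
  have hab : IsBest rk a O (x b) → A ++ a :: Z ∈ crawlWords rk x S O → a = b := by
    intro h1 h2
    have hl := length_of_mem_crawlWords h2
    exact hx ((crawlsTo_delete hinj huni hO (by omega) hob h1).1 (mem_crawlWords.1 h2).2).1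
  have hp : (A ++ a :: Z).Perm (a :: (A ++ Z)) := List.perm_middle
  have hset : a = b → (((A ++ a :: Z).Nodup ∧ (A ++ a :: Z).toFinset = S) ↔
      ((A ++ Z).Nodup ∧ (A ++ Z).toFinset = S.erase b)) := by
    rintro rfl
    rw [hp.nodup_iff, List.toFinset_eq_of_perm _ _ hp, List.nodup_cons, List.toFinset_cons]
    constructor
    · rintro ⟨⟨h1, h2⟩, rfl⟩
      exact ⟨h2, by rw [Finset.erase_insert (by simpa using h1)]⟩
    · rintro ⟨h1, h2⟩
      refine ⟨⟨fun h => ?_, h1⟩, by rw [h2, Finset.insert_erase hb]⟩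
      have : a ∈ (A ++ Z).toFinset := by simpa using h
      simp [h2] at this
  constructor
  · rintro ⟨h1, h2⟩
    obtain rfl := hab h2 h1
    have hl := length_of_mem_crawlWords h1
    rw [mem_crawlWords] at h1 ⊢
    exact ⟨rfl, h2, (hset rfl).1 h1.1, ((crawlsTo_delete hinj huni hO (by omega) hob h2).1 h1.2).2⟩
  · rintro ⟨rfl, h2, h1⟩
    have hl := length_of_mem_crawlWords h1
    rw [Finset.card_erase_of_mem hb] at hl
    have : 0 < S.card := Finset.card_pos.2 ⟨a, hb⟩
    rw [mem_crawlWords] at h1 ⊢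
    exact ⟨⟨(hset rfl).2 h1.1, (crawlsTo_delete hinj huni hO
      (by simp at hl ⊢; omega) hob h2).2 ⟨rfl, h1.2⟩⟩, h2⟩

open scoped Classical in
lemma card_bestAt (hinj : ∀ a, Function.Injective (rk a)) (huni : Unimodal rk)
    (hO : O.Pairwise (· < ·)) (hlen : O.length = S.card) (hOS : O.toFinset = S.image x)
    (hx : Function.Injective x) {i : ℕ} {b : Fin n} (hb : b ∈ S) (hob : O[i]? = some (x b)) :
    ((crawlWords rk x S O).filter fun w => BestAt rk O w i i).card =
      if Content rk x S b then (crawlWords rk x (S.erase b) (O.erase (x b))).card else 0 := by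
  have hi : i < O.length := (List.getElem?_eq_some_iff.1 hob).1
  have hsplit : ∀ w ∈ crawlWords rk x S O, ∃ A a Z, w = A ++ a :: Z ∧ A.length = i := by
    intro w hw
    have hl := length_of_mem_crawlWords hw
    obtain ⟨A, Z, h⟩ := exists_eq_append_of_getElem? (w := w) (i := i) (a := w[i]) (by simp)
    exact ⟨A, _, Z, h⟩
  rw [← isBest_iff_content hOS hb]
  split_ifs with hbest
  · refine Finset.card_nbij' (fun w => w.take i ++ w.drop (i + 1))
      (fun v => v.take i ++ b :: v.drop i) ?_ ?_ ?_ ?_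
    · intro w hw
      simp only [Finset.coe_filter, Set.mem_ofPred_eq, Finset.mem_coe] at hw ⊢
      obtain ⟨A, a, Z, rfl, rfl⟩ := hsplit w hw.1
      have := ((mem_crawlWords_delete hinj huni hO hlen hb hx hob).1 hw).2.2
      simpa using this
    · intro v hv
      simp only [Finset.coe_filter, Set.mem_ofPred_eq, Finset.mem_coe] at hv ⊢
      have hl := length_of_mem_crawlWords hv
      rw [Finset.card_erase_of_mem hb] at hl
      have hlt : (v.take i).length = i := by simp; omega
      have := mem_crawlWords_delete (A := v.take i) (Z := v.drop i) (a := b) hinj huni hO hlen hb hx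
        (by rwa [hlt])
      rw [hlt, List.take_append_drop] at this
      exact this.2 ⟨rfl, hbest, hv⟩
    · intro w hw
      simp only [Finset.coe_filter, Set.mem_ofPred_eq] at hw
      obtain ⟨A, a, Z, rfl, rfl⟩ := hsplit w hw.1
      obtain rfl := ((mem_crawlWords_delete hinj huni hO hlen hb hx hob).1 hw).1
      simp
    · intro v hv
      simp only [Finset.mem_coe] at hv
      have hl := length_of_mem_crawlWords hv
      rw [Finset.card_erase_of_mem hb] at hl
      have hlt : (v.take i).length = i := by simp; omega
      have h1 : (v.take i ++ b :: v.drop i).take i = v.take i := by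
        rw [List.take_left' hlt]
      have h2 : (v.take i ++ b :: v.drop i).drop (i + 1) = v.drop i := by
        rw [← List.drop_drop, List.drop_left' hlt]; rfl
      simp only [h1, h2, List.take_append_drop]
  · rw [Finset.card_eq_zero, Finset.filter_eq_empty_iff]
    intro w hw h
    obtain ⟨A, a, Z, rfl, rfl⟩ := hsplit w hw
    exact hbest ((mem_crawlWords_delete hinj huni hO hlen hb hx hob).1 ⟨hw, h⟩).2.1

lemma length_eq_card (hO : O.Nodup) (hOS : O.toFinset = S.image x) (hx : Function.Injective x) :
    O.length = S.card := by
  rw [← List.toFinset_card_of_nodup hO, hOS, Finset.card_image_of_injective _ hx]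

open scoped Classical in
/-- The recursion satisfied by the number of initial orders leading to a given allocation. -/
lemma card_crawlWords (hinj : ∀ a, Function.Injective (rk a)) (huni : Unimodal rk)
    (hO : O.Pairwise (· < ·)) (hOS : O.toFinset = S.image x)
    (hx : Function.Injective x) (hS : S.Nonempty) :
    (crawlWords rk x S O).card = ∑ b ∈ S with Content rk x S b,
      (crawlWords rk x (S.erase b) (O.erase (x b))).card := by
  have hlen := length_eq_card hO.nodup hOS hx
  have hO0 : O ≠ [] := by
    rintro rfl
    have := hS.card_pos
    simp at hlen
    omega
  have hmem : ∀ o, o ∈ O ↔ ∃ b ∈ S, x b = o := fun o => by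
    rw [← List.mem_toFinset, hOS, Finset.mem_image]
  rw [card_crawlWords_eq_sum_range hinj huni hO hlen hO0, Finset.sum_filter]
  symm
  refine Finset.sum_bij (fun b _ => O.idxOf (x b)) ?_ ?_ ?_ ?_
  · intro b hb
    rw [Finset.mem_range, List.idxOf_lt_length_iff, hmem]
    exact ⟨b, hb, rfl⟩
  · intro b hb c hc h
    exact hx ((List.idxOf_inj ((hmem _).2 ⟨b, hb, rfl⟩)).1 h)
  · intro i hi
    rw [Finset.mem_range] at hi
    obtain ⟨b, hb, hbi⟩ := (hmem O[i]).1 (by simp)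
    exact ⟨b, hb, by rw [hbi, hO.nodup.idxOf_getElem]⟩
  · intro b hb
    rw [card_bestAt hinj huni hO hlen hOS hx hb]
    exact List.getElem?_idxOf ((hmem _).2 ⟨b, hb, rfl⟩)

lemma card_crawlWords_empty : (crawlWords rk x ∅ []).card = 1 := by
  rw [Finset.card_eq_one]
  refine ⟨[], ?_⟩
  ext w
  rw [mem_crawlWords]
  simp only [List.toFinset_eq_empty_iff, Finset.mem_singleton]
  constructor
  · exact fun h => h.1.2
  · rintro rfl
    simp [CrawlsTo, crawlAux]

end CrawlerCount

section Lookup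

lemma lookup_eq_some_of_mem {l : List (Fin n × Fin n)} (h : (l.map Prod.fst).Nodup)
    {p : Fin n × Fin n} (hp : p ∈ l) : l.lookup p.1 = some p.2 := by
  induction l with
  | nil => simp at hp
  | cons q l ih =>
    rw [List.map_cons, List.nodup_cons] at h
    rcases List.mem_cons.1 hp with rfl | hp
    · simp [List.lookup]
    · have hne : p.1 ≠ q.1 := fun he => h.1 (he ▸ List.mem_map_of_mem hp)
      rw [List.lookup_cons, beq_eq_false_iff_ne.2 hne]
      exact ih h.2 hp

lemma lookup_getD_eq_iff {l : List (Fin n × Fin n)} (h : (l.map Prod.fst).Perm (List.finRange n))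
    (d x : Fin n → Fin n) :
    (fun i => (l.lookup i).getD (d i)) = x ↔ ∀ p ∈ l, x p.1 = p.2 := by
  have hnd : (l.map Prod.fst).Nodup := h.nodup_iff.2 (List.nodup_finRange n)
  constructor
  · rintro rfl p hp
    simp [lookup_eq_some_of_mem hnd hp]
  · intro hx
    funext i
    obtain ⟨p, hp, rfl⟩ := List.mem_map.1 (h.mem_iff.2 (List.mem_finRange i))
    simp [lookup_eq_some_of_mem hnd hp, hx p hp]

end Lookup

section CrawlerEndowments

variable {rk : Fin n → Fin n → Fin n}

lemma findIdx2_lt {w O : List (Fin n)} (hw : w ≠ []) (hlen : O.length = w.length) :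
    findIdx2 rk w O < w.length := by
  induction w generalizing O with
  | nil => exact absurd rfl hw
  | cons a w ih =>
    rcases O with _ | ⟨u, _ | ⟨v, O⟩⟩
    · simp [findIdx2]
    · simp [findIdx2]
    · rw [findIdx2]
      split_ifs
      · simp
      · have hw' : w ≠ [] := by rintro rfl; simp at hlen
        simpa using ih (O := v :: O) hw' (by simpa using hlen)

lemma map_fst_crawlAux {w O : List (Fin n)} (hlen : O.length = w.length) :
    ((crawlAux rk w.length w O).map Prod.fst).Perm w := by
  obtain ⟨m, hm⟩ : ∃ m, w.length = m := ⟨_, rfl⟩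
  rw [hm]
  induction m generalizing w O with
  | zero =>
    rw [List.length_eq_zero_iff.1 hm]
    simp [crawlAux]
  | succ m ih =>
    have ht : findIdx2 rk w O < w.length := findIdx2_lt (by rintro rfl; simp at hm) hlen
    rcases w with _ | ⟨a0, w⟩
    · simp at hm
    rcases O with _ | ⟨o0, O⟩
    · simp at hlen
    obtain ⟨o, ho⟩ := exists_isBest (rk := rk)
      ((a0 :: w).getD (findIdx2 rk (a0 :: w) (o0 :: O)) a0) (List.cons_ne_nil o0 O)
    simp only [crawlAux, List.map_cons]
    refine (List.Perm.cons _ (ih ?_ ?_)).trans ?_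
    · rw [List.length_erase_of_mem, List.length_eraseIdx_of_lt ht, hlen]
      rcases hmin : (o0 :: O).argmin
        (rk ((a0 :: w).getD (findIdx2 rk (a0 :: w) (o0 :: O)) a0)) with _ | p
      · simp
      · exact List.argmin_mem hmin
    · rw [List.length_eraseIdx_of_lt ht]
      omega
    · rw [List.getD_eq_getElem _ _ ht]
      exact List.getElem_cons_eraseIdx_perm ht

lemma ownersList_eq (ω : Equiv.Perm (Fin n)) : ownersList ω = (List.finRange n).map ω.symm := by
  rw [ownersList, ← List.filterMap_eq_map]
  refine List.filterMap_congr fun o _ => ?_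
  rw [Function.comp_apply]
  have : (fun a => ω a == o) = fun a => a == ω.symm o := by
    funext a
    rw [Bool.eq_iff_iff]
    simp [Equiv.eq_symm_apply]
  rw [this]
  rcases hf : (List.finRange n).find? (fun a => a == ω.symm o) with _ | b
  · exact absurd (List.find?_eq_none.1 hf (ω.symm o) (List.mem_finRange _)) (by simp)
  · simpa using List.find?_some hf

lemma CRfun_eq_iff (ω x : Equiv.Perm (Fin n)) : CRfun rk ω = x ↔
    (List.finRange n).map ω.symm ∈ crawlWords rk x Finset.univ (List.finRange n) := by
  have hperm : ((List.finRange n).map ω.symm).Perm (List.finRange n) := by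
    rw [List.perm_ext_iff_of_nodup ((List.nodup_finRange n).map ω.symm.injective)
      (List.nodup_finRange n)]
    intro a
    simp only [List.mem_finRange, iff_true, List.mem_map, true_and]
    exact ⟨ω a, by simp⟩
  have hl : ((List.finRange n).map ω.symm).length = n := by simp
  have hkeys := map_fst_crawlAux (rk := rk) (w := (List.finRange n).map ω.symm)
    (O := List.finRange n) (by simp)
  have := lookup_getD_eq_iff (hkeys.trans hperm) ω x
  rw [mem_crawlWords, and_iff_right]
  · rw [CrawlsTo, ← this, hl, ← ownersList_eq]
    rfl
  · refine ⟨hperm.nodup_iff.2 (List.nodup_finRange n), ?_⟩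
    rw [List.toFinset_eq_of_perm _ _ hperm, List.toFinset_finRange]

lemma card_CRfun_eq (x : Equiv.Perm (Fin n)) :
    (Finset.univ.filter fun ω : Equiv.Perm (Fin n) => CRfun rk ω = x).card =
      (crawlWords rk x Finset.univ (List.finRange n)).card := by
  refine Finset.card_bij (fun ω _ => (List.finRange n).map ω.symm) ?_ ?_ ?_
  · intro ω hω
    exact (CRfun_eq_iff ω x).1 (Finset.mem_filter.1 hω).2
  · intro ω _ ω' _ h
    rw [List.map_inj_left] at h
    exact Equiv.symm_bijective.injective (Equiv.ext fun o => h o (List.mem_finRange o))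
  · intro w hw
    have hl := length_of_mem_crawlWords hw
    rw [Finset.card_univ, Fintype.card_fin] at hl
    have hnd := (mem_crawlWords.1 hw).1.1
    have hinj : Function.Injective fun i : Fin n => w[i]'(by omega) := by
      intro i j h
      exact Fin.ext ((hnd.getElem_inj_iff).1 h)
    let σ : Equiv.Perm (Fin n) := Equiv.ofBijective _ (Finite.injective_iff_bijective.1 hinj)
    have hσ : (List.finRange n).map σ.symm.symm = w := by
      refine List.ext_getElem (by simp [hl]) fun i h1 h2 => ?_
      simp [σ]
    refine ⟨σ.symm, ?_, hσ⟩
    rw [Finset.mem_filter, CRfun_eq_iff, hσ]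
    exact ⟨Finset.mem_univ _, hw⟩

end CrawlerEndowments

section Clearing

/-- The agents of `S` can leave in successive groups, each stable under `σ`, whose members like
their own objects best among those of the agents still present. -/
inductive Clears (rk : Fin n → Fin n → Fin n) (x : Fin n → Fin n) (σ : Equiv.Perm (Fin n)) :
    Finset (Fin n) → Prop
  | empty : Clears rk x σ ∅
  | step {S A : Finset (Fin n)} : A ⊆ S → (∀ a ∈ A, σ a ∈ A) → (∀ a ∈ A, Content rk x S a) →
      Clears rk x σ (S \ A) → Clears rk x σ S

variable {rk : Fin n → Fin n → Fin n} {x : Fin n → Fin n} {σ τ : Equiv.Perm (Fin n)}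
  {S A : Finset (Fin n)}

lemma Content.mono {T : Finset (Fin n)} {a : Fin n} (h : Content rk x S a) (hTS : T ⊆ S) :
    Content rk x T a :=
  fun b hb => h b (hTS hb)

lemma mem_of_apply_mem (hA : ∀ a ∈ A, σ a ∈ A) {a : Fin n} (ha : σ a ∈ A) : a ∈ A := by
  have h : A.image σ = A := Finset.eq_of_subset_of_card_le (Finset.image_subset_iff.2 hA)
    (Finset.card_image_of_injective _ σ.injective).ge
  rw [← h, Finset.mem_image] at ha
  obtain ⟨b, hb, h⟩ := ha
  rwa [← σ.injective h]

lemma apply_mem_sdiff {B : Finset (Fin n)} (hA : ∀ a ∈ A, σ a ∈ A) (hB : ∀ a ∈ B, σ a ∈ B) :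
    ∀ a ∈ B \ A, σ a ∈ B \ A := by
  intro a ha
  rw [Finset.mem_sdiff] at ha ⊢
  exact ⟨hB a ha.1, fun h => ha.2 (mem_of_apply_mem hA h)⟩

lemma Clears.sdiff (hS : Clears rk x σ S) (hA : ∀ a ∈ A, σ a ∈ A)
    (hc : ∀ a ∈ A, Content rk x S a) : Clears rk x σ (S \ A) := by
  induction hS generalizing A with
  | empty => simpa using Clears.empty
  | @step S B hBS hB hcB _ ih =>
    refine Clears.step (A := B \ A) (Finset.sdiff_subset_sdiff hBS le_rfl)
      (apply_mem_sdiff hA hB) (fun a ha => (hcB a (Finset.mem_sdiff.1 ha).1).mono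
        Finset.sdiff_subset) ?_
    have := ih (A := A \ B) (apply_mem_sdiff hB hA)
      fun a ha => (hc a (Finset.mem_sdiff.1 ha).1).mono Finset.sdiff_subset
    convert this using 1
    ext a
    simp only [Finset.mem_sdiff]
    tauto

lemma Clears.congr (hS : Clears rk x σ S) (h : ∀ a ∈ S, σ a = τ a) : Clears rk x τ S := by
  induction hS with
  | empty => exact Clears.empty
  | @step S B hBS hB hcB _ ih =>
    exact Clears.step hBS (fun a ha => h a (hBS ha) ▸ hB a ha) hcB
      (ih fun a ha => h a (Finset.mem_sdiff.1 ha).1)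

lemma Clears.exists_closed (hS : Clears rk x σ S) (hne : S.Nonempty) :
    ∃ A ⊆ S, A.Nonempty ∧ (∀ a ∈ A, σ a ∈ A) ∧ ∀ a ∈ A, Content rk x S a := by
  induction hS with
  | empty => simp at hne
  | @step S B hBS hB hcB _ ih =>
    rcases B.eq_empty_or_nonempty with rfl | hBne
    · rw [Finset.sdiff_empty] at ih
      exact ih hne
    · exact ⟨B, hBS, hBne, hB, hcB⟩

open scoped Classical in
/-- The largest part of `S` that is stable under `σ` and all of whose members are content. -/
noncomputable def leavers (rk : Fin n → Fin n → Fin n) (x : Fin n → Fin n)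
    (S : Finset (Fin n)) (σ : Equiv.Perm (Fin n)) : Finset (Fin n) :=
  S.filter fun a => ∀ k : ℕ, σ^[k] a ∈ S ∧ Content rk x S (σ^[k] a)

lemma leavers_subset : leavers rk x S σ ⊆ S := by
  intro a ha
  simp only [leavers, Finset.mem_filter] at ha
  exact ha.1

lemma apply_mem_leavers : ∀ a ∈ leavers rk x S σ, σ a ∈ leavers rk x S σ := by
  intro a ha
  simp only [leavers, Finset.mem_filter] at ha ⊢
  exact ⟨(ha.2 1).1, fun k => by simpa [Function.iterate_succ_apply] using ha.2 (k + 1)⟩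

lemma content_of_mem_leavers {a : Fin n} (ha : a ∈ leavers rk x S σ) : Content rk x S a := by
  simp only [leavers, Finset.mem_filter] at ha
  exact (ha.2 0).2

lemma subset_leavers (hAS : A ⊆ S) (hA : ∀ a ∈ A, σ a ∈ A) (hc : ∀ a ∈ A, Content rk x S a) :
    A ⊆ leavers rk x S σ := by
  intro a ha
  have : ∀ k : ℕ, σ^[k] a ∈ A := by
    intro k
    induction k with
    | zero => exact ha
    | succ k ih => rw [Function.iterate_succ_apply']; exact hA _ ih
  simp only [leavers, Finset.mem_filter]
  exact ⟨hAS ha, fun k => ⟨hAS (this k), hc _ (this k)⟩⟩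

lemma leavers_subset_mul_swap {p q : Fin n} (hp : p ∈ leavers rk x S σ)
    (hq : q ∈ leavers rk x S σ) : leavers rk x S σ ⊆ leavers rk x S (σ * Equiv.swap p q) := by
  refine subset_leavers leavers_subset (fun a ha => ?_) fun a ha => content_of_mem_leavers ha
  refine apply_mem_leavers _ ?_
  rw [Equiv.swap_apply_def]
  split_ifs <;> assumption

lemma leavers_mul_swap {p q : Fin n} (hp : p ∈ leavers rk x S σ) (hq : q ∈ leavers rk x S σ) :
    leavers rk x S (σ * Equiv.swap p q) = leavers rk x S σ := by
  have h := leavers_subset_mul_swap hp hq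
  refine Finset.Subset.antisymm ?_ h
  have := leavers_subset_mul_swap (h hp) (h hq)
  rwa [mul_assoc, Equiv.swap_mul_self, mul_one] at this

lemma Clears.mul_swap (hS : Clears rk x σ S) {p q : Fin n} (hp : p ∈ leavers rk x S σ)
    (hq : q ∈ leavers rk x S σ) : Clears rk x (σ * Equiv.swap p q) S := by
  refine Clears.step (A := leavers rk x S σ) leavers_subset ?_
    (fun a ha => content_of_mem_leavers ha) ?_
  · rw [← leavers_mul_swap hp hq]
    exact apply_mem_leavers
  · refine (hS.sdiff apply_mem_leavers fun a ha => content_of_mem_leavers ha).congr fun a ha => ?_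
    have ha' := (Finset.mem_sdiff.1 ha).2
    rw [Equiv.Perm.mul_apply, Equiv.swap_apply_of_ne_of_ne] <;> rintro rfl <;> contradiction

open scoped Classical in
/-- The permutations of `S` along which the agents of `S` can leave. -/
noncomputable def clearingPerms (rk : Fin n → Fin n → Fin n) (x : Fin n → Fin n)
    (S : Finset (Fin n)) : Finset (Equiv.Perm (Fin n)) :=
  Finset.univ.filter fun σ => (∀ a ∉ S, σ a = a) ∧ Clears rk x σ S

lemma mem_clearingPerms :
    σ ∈ clearingPerms rk x S ↔ (∀ a ∉ S, σ a = a) ∧ Clears rk x σ S := by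
  simp [clearingPerms]

lemma mem_clearingPerms_erase {a : Fin n} (ha : a ∈ S) (hc : Content rk x S a) :
    σ ∈ clearingPerms rk x (S.erase a) ↔ σ ∈ clearingPerms rk x S ∧ σ a = a := by
  simp only [mem_clearingPerms, ← Finset.sdiff_singleton_eq_erase]
  constructor
  · rintro ⟨h1, h2⟩
    have haa : σ a = a := h1 a (by simp)
    exact ⟨⟨fun b hb => h1 b fun hb' => hb (Finset.mem_sdiff.1 hb').1,
      Clears.step (by simpa using ha) (by simpa using haa) (by simpa using hc) h2⟩, haa⟩
  · rintro ⟨⟨h1, h2⟩, haa⟩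
    refine ⟨fun b hb => ?_, h2.sdiff (by simpa using haa) (by simpa using hc)⟩
    by_cases hba : b = a
    · rwa [hba]
    · exact h1 b fun hb' => hb (by simp [hb', hba])

open scoped Classical in
lemma card_clearingPerms (hS : S.Nonempty) :
    (clearingPerms rk x S).card = ∑ a ∈ S with Content rk x S a,
      (clearingPerms rk x (S.erase a)).card := by
  obtain ⟨a0, -⟩ := id hS
  obtain ⟨pick, hpick⟩ : ∃ f : Finset (Fin n) → Fin n, ∀ U, U.Nonempty → f U ∈ U :=
    ⟨fun U => if h : U.Nonempty then h.choose else a0, fun U h => by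
      simpa [h] using h.choose_spec⟩
  have hne : ∀ σ ∈ clearingPerms rk x S, pick (leavers rk x S σ) ∈ leavers rk x S σ := by
    intro σ hσ
    obtain ⟨A, hAS, hA, hcl, hc⟩ := (mem_clearingPerms.1 hσ).2.exists_closed hS
    exact hpick _ (hA.mono (subset_leavers hAS hcl hc))
  have hswap : ∀ σ ∈ clearingPerms rk x S, ∀ p ∈ leavers rk x S σ, ∀ q ∈ leavers rk x S σ,
      σ * Equiv.swap p q ∈ clearingPerms rk x S := by
    intro σ hσ p hp q hq
    rw [mem_clearingPerms] at hσ ⊢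
    refine ⟨fun b hb => ?_, hσ.2.mul_swap hp hq⟩
    rw [Equiv.Perm.mul_apply, Equiv.swap_apply_of_ne_of_ne, hσ.1 b hb] <;> rintro rfl
    · exact hb (leavers_subset hp)
    · exact hb (leavers_subset hq)
  have hfix : ∀ a ∈ S, Content rk x S a → ∀ σ : Equiv.Perm (Fin n), σ a = a →
      a ∈ leavers rk x S σ := by
    intro a ha hc σ haa
    exact subset_leavers (A := {a}) (by simpa using ha) (by simpa using haa) (by simpa using hc)
      (Finset.mem_singleton_self a)
  rw [← Finset.card_sigma]
  refine Finset.card_bij'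
    (fun σ _ => ⟨σ (pick (leavers rk x S σ)),
      σ * Equiv.swap (pick (leavers rk x S σ)) (σ (pick (leavers rk x S σ)))⟩)
    (fun p _ => p.2 * Equiv.swap (pick (leavers rk x S p.2)) p.1) ?_ ?_ ?_ ?_
  · intro σ hσ
    have hu := hne σ hσ
    have hv := apply_mem_leavers _ hu
    simp only [Finset.mem_sigma, Finset.mem_filter]
    refine ⟨⟨leavers_subset hv, content_of_mem_leavers hv⟩, ?_⟩
    rw [mem_clearingPerms_erase (leavers_subset hv) (content_of_mem_leavers hv)]
    exact ⟨hswap σ hσ _ hu _ hv, by simp⟩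
  · rintro ⟨a, τ⟩ h
    simp only [Finset.mem_sigma, Finset.mem_filter] at h
    rw [mem_clearingPerms_erase h.1.1 h.1.2] at h
    exact hswap τ h.2.1 _ (hne τ h.2.1) _ (hfix a h.1.1 h.1.2 τ h.2.2)
  · intro σ hσ
    have hu := hne σ hσ
    have hv := apply_mem_leavers _ hu
    simp only
    rw [leavers_mul_swap hu hv, mul_assoc, Equiv.swap_mul_self, mul_one]
  · rintro ⟨a, τ⟩ h
    simp only [Finset.mem_sigma, Finset.mem_filter] at h
    rw [mem_clearingPerms_erase h.1.1 h.1.2] at h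
    have hu := hne τ h.2.1
    have hv := hfix a h.1.1 h.1.2 τ h.2.2
    have h1 : (τ * Equiv.swap (pick (leavers rk x S τ)) a) (pick (leavers rk x S τ)) = a := by
      simp [h.2.2]
    simp only
    rw [leavers_mul_swap hu hv, h1, mul_assoc, Equiv.swap_mul_self, mul_one]

lemma card_clearingPerms_empty : (clearingPerms rk x ∅).card = 1 := by
  rw [Finset.card_eq_one]
  refine ⟨1, ?_⟩
  ext σ
  rw [mem_clearingPerms, Finset.mem_singleton]
  constructor
  · rintro ⟨h, -⟩
    exact Equiv.ext fun a => h a (Finset.notMem_empty a)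
  · rintro rfl
    exact ⟨fun _ _ => rfl, Clears.empty⟩

/-- The agents on the cycles of the first round are content when the market clears. -/
lemma Clears.content_of_cycle (hS : Clears rk x σ S) (hrk : ∀ a, Function.Injective (rk a))
    (hx : Function.Injective x) {t : Fin n → Fin n} {K : Finset (Fin n)} (hKS : K ⊆ S)
    (ht : ∀ b ∈ K, t b ∈ S) (hbest : ∀ b ∈ K, ∀ c ∈ S, rk b (x (t b)) ≤ rk b (x c))
    (hK : ∀ b ∈ K, σ (t b) ∈ K) (hinj : Set.InjOn (fun b => σ (t b)) K) :
    ∀ b ∈ K, Content rk x S b := by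
  induction hS generalizing K with
  | empty => exact fun b hb => absurd (hKS hb) (Finset.notMem_empty b)
  | @step S A hAS hA hcA _ ih =>
    have hfix : ∀ a ∈ K, a ∈ A → t a = a := fun a haK haA =>
      hx (hrk a (le_antisymm (hbest a haK a (hAS haA)) (hcA a haA _ (ht a haK))))
    have himg : (K ∩ A).image (fun b => σ (t b)) = K ∩ A := by
      refine Finset.eq_of_subset_of_card_le (Finset.image_subset_iff.2 fun a ha => ?_) ?_
      · rw [Finset.mem_inter] at ha ⊢
        refine ⟨hK a ha.1, ?_⟩
        rw [hfix a ha.1 ha.2]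
        exact hA a ha.2
      · exact (Finset.card_image_of_injOn (hinj.mono (by simp))).ge
    have hout : ∀ b ∈ K \ A, σ (t b) ∉ A := by
      intro b hb hA'
      rw [Finset.mem_sdiff] at hb
      have : σ (t b) ∈ K ∩ A := Finset.mem_inter.2 ⟨hK b hb.1, hA'⟩
      rw [← himg, Finset.mem_image] at this
      obtain ⟨c, hc, h⟩ := this
      rw [Finset.mem_inter] at hc
      exact hb.2 (hinj hc.1 hb.1 h ▸ hc.2)
    have htA : ∀ b ∈ K \ A, t b ∈ S \ A := fun b hb =>
      Finset.mem_sdiff.2 ⟨ht b (Finset.mem_sdiff.1 hb).1, fun h => hout b hb (hA _ h)⟩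
    intro b hb
    by_cases hbA : b ∈ A
    · exact hcA b hbA
    have hbK : b ∈ K \ A := Finset.mem_sdiff.2 ⟨hb, hbA⟩
    have := ih (K := K \ A) (Finset.sdiff_subset_sdiff hKS le_rfl) htA
      (fun b hb c hc => hbest b (Finset.mem_sdiff.1 hb).1 c (Finset.mem_sdiff.1 hc).1)
      (fun b hb => Finset.mem_sdiff.2 ⟨hK b (Finset.mem_sdiff.1 hb).1, hout b hb⟩)
      (hinj.mono (by simp)) b hbK
    exact fun c hc => (this _ (htA b hbK)).trans (hbest b hb c hc)

end Clearing

section TopTradingCycles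

open Function

lemma mem_periodicPts_iff_any {f : Fin n → Fin n} {L : List (Fin n)} (hf : ∀ a, f a ∈ L)
    (a : Fin n) :
    ((List.range L.length).any fun k => f^[k + 1] a == a) = true ↔ a ∈ periodicPts f := by
  simp only [List.any_eq_true, List.mem_range, beq_iff_eq]
  constructor
  · rintro ⟨k, -, h⟩
    exact mk_mem_periodicPts k.succ_pos h
  · intro h
    have hpos := minimalPeriod_pos_of_mem_periodicPts h
    have hper : f^[minimalPeriod f a] a = a := isPeriodicPt_minimalPeriod f a
    have hmem : ∀ k : ℕ, f^[k] a ∈ L := by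
      rintro (_ | k)
      · rw [← Nat.succ_pred_eq_of_pos hpos, iterate_succ_apply'] at hper
        rw [iterate_zero_apply, ← hper]
        exact hf _
      · rw [iterate_succ_apply']
        exact hf _
    have hle : (Finset.range (minimalPeriod f a)).card ≤ L.toFinset.card := by
      refine Finset.card_le_card_of_injOn (fun k => f^[k] a) (fun k _ => by simpa using hmem k) ?_
      simpa using iterate_injOn_Iio_minimalPeriod (f := f) (x := a)
    rw [Finset.card_range] at hle
    have := List.toFinset_card_le L
    exact ⟨minimalPeriod f a - 1, by omega, by rwa [Nat.sub_add_cancel hpos]⟩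

lemma exists_mem_periodicPts (f : Fin n → Fin n) (a : Fin n) : ∃ b, f b ∈ periodicPts f := by
  obtain ⟨i, j, hij, h⟩ := Finite.exists_ne_map_eq_of_infinite fun k : ℕ => f^[k] a
  wlog hlt : i < j generalizing i j
  · exact this j i hij.symm h.symm (by omega)
  refine ⟨f^[i] a, (bijOn_periodicPts f).mapsTo (mk_mem_periodicPts (n := j - i) (by omega) ?_)⟩
  rw [IsPeriodicPt, IsFixedPt, ← iterate_add_apply, Nat.sub_add_cancel hlt.le]
  exact h.symm

variable {rk : Fin n → Fin n → Fin n}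

open scoped Classical in
lemma TTCAux_succ (hinj : ∀ a, Injective (rk a)) {agents objects : List (Fin n)}
    {own top : Fin n → Fin n} (hne : agents ≠ []) (htop : ∀ a, IsBest rk a objects (top a))
    (hown : ∀ o ∈ objects, own o ∈ agents) (m : ℕ) :
    TTCAux rk (m + 1) agents objects own =
      ((agents.filter (· ∈ periodicPts (own ∘ top))).map fun a => (a, top a)) ++
        TTCAux rk m (agents.filter (· ∉ periodicPts (own ∘ top)))
          (objects.filter fun o => ∀ a ∈ agents, a ∈ periodicPts (own ∘ top) → top a ≠ o) own := by
  obtain ⟨a0, L, rfl⟩ := List.exists_cons_of_ne_nil hne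
  have h1 : (fun a => (objects.argmin (rk a)).getD a0) = top := by
    funext a
    rw [(htop a).argmin_eq hinj, Option.getD_some]
  have h2 : (fun a => (List.range (a0 :: L).length).any fun k => (own ∘ top)^[k + 1] a == a) =
      fun a => decide (a ∈ periodicPts (own ∘ top)) := by
    funext a
    rw [Bool.eq_iff_iff, mem_periodicPts_iff_any (f := own ∘ top) fun a => hown _ (htop a).1, decide_eq_true_iff]
  have h3 : (fun a => own ((objects.argmin (rk a)).getD a0)) = own ∘ top := by
    rw [← h1]
    rfl
  simp only [TTCAux, h3]
  simp only [congrFun h1, congrFun h2]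
  congr 2
  · refine List.filter_congr fun a _ => ?_
    simp
  · refine List.filter_congr fun o _ => ?_
    rw [Bool.eq_iff_iff]
    simp [-List.mem_cons]

lemma TTCAux_spec (hinj : ∀ a, Injective (rk a)) (x own : Equiv.Perm (Fin n)) {m : ℕ}
    {agents objects : List (Fin n)} (hm : agents.length ≤ m) (hnd : agents.Nodup)
    (hown : ∀ o, o ∈ objects ↔ own o ∈ agents) :
    ((TTCAux rk m agents objects own).map Prod.fst).Perm agents ∧
      ((∀ o, o ∈ objects ↔ x.symm o ∈ agents) →
        ((∀ p ∈ TTCAux rk m agents objects own, x p.1 = p.2) ↔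
          Clears rk x (x.trans own) agents.toFinset)) := by
  classical
  induction m generalizing agents objects with
  | zero =>
    obtain rfl : agents = [] := List.length_eq_zero_iff.1 (by omega)
    simp [TTCAux, Clears.empty]
  | succ m ih =>
    by_cases hne : agents = []
    · subst hne
      simp [TTCAux, Clears.empty]
    obtain ⟨a0, ha0⟩ := List.exists_mem_of_ne_nil _ hne
    have hO : objects ≠ [] := List.ne_nil_of_mem ((hown (own.symm a0)).2 (by simpa using ha0))
    choose top htop using fun a => exists_isBest (rk := rk) a hO
    set f := own ∘ top with hf
    have hfm : ∀ a, f a ∈ agents := fun a => (hown _).1 (htop a).1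
    have hbij := bijOn_periodicPts f
    have hper : ∀ a ∈ periodicPts f, a ∈ agents := by
      intro a ha
      obtain ⟨b, -, rfl⟩ := hbij.surjOn ha
      exact hfm b
    have hstep := TTCAux_succ (top := top) hinj hne htop (fun o => (hown o).1) m
    rw [← hf] at hstep
    have hlt : (agents.filter (· ∉ periodicPts f)).length ≤ m := by
      obtain ⟨b, hb⟩ := exists_mem_periodicPts f a0
      have : (agents.filter (· ∉ periodicPts f)).length < agents.length :=
        List.length_filter_lt_length_iff_exists.2 ⟨f b, hfm b, by simpa using hb⟩
      omega
    have hobj : ∀ o, o ∈ objects → ((∃ a ∈ periodicPts f, top a = o) ↔ own o ∈ periodicPts f) := by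
      intro o _
      constructor
      · rintro ⟨a, ha, rfl⟩
        exact hbij.mapsTo ha
      · intro h
        obtain ⟨b, hb, hbo⟩ := hbij.surjOn h
        exact ⟨b, hb, own.injective hbo⟩
    have hmem : ∀ o, o ∈ objects.filter (fun o => ∀ a ∈ agents, a ∈ periodicPts f → top a ≠ o) ↔
        o ∈ objects ∧ ¬ ∃ a ∈ periodicPts f, top a = o := by
      intro o
      simp only [List.mem_filter, decide_eq_true_eq, and_congr_right_iff]
      intro _
      push Not
      exact ⟨fun h a ha => h a (hper a ha) ha, fun h a _ ha => h a ha⟩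
    have hown' : ∀ o, o ∈ objects.filter
        (fun o => ∀ a ∈ agents, a ∈ periodicPts f → top a ≠ o) ↔
        own o ∈ agents.filter (· ∉ periodicPts f) := by
      intro o
      rw [hmem, List.mem_filter, ← hown, decide_eq_true_eq]
      exact and_congr_right fun h => not_congr (hobj o h)
    obtain ⟨ih1, ih2⟩ := ih hlt (hnd.filter _) hown'
    refine ⟨?_, fun hx => ?_⟩
    · rw [hstep, List.map_append, List.map_map]
      have : (agents.filter (· ∈ periodicPts f)).map (Prod.fst ∘ fun a => (a, top a)) =
          agents.filter (· ∈ periodicPts f) := by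
        exact List.map_id _
      rw [this]
      refine (ih1.append_left _).trans ?_
      have := List.filter_append_perm (fun a => decide (a ∈ periodicPts f)) agents
      simpa using this
    · have hsplit : (∀ p ∈ TTCAux rk (m + 1) agents objects own, x p.1 = p.2) ↔
          (∀ a ∈ periodicPts f, x a = top a) ∧
          ∀ p ∈ TTCAux rk m (agents.filter (· ∉ periodicPts f))
            (objects.filter fun o => ∀ a ∈ agents, a ∈ periodicPts f → top a ≠ o) own,
            x p.1 = p.2 := by
        rw [hstep, List.forall_mem_append]
        refine and_congr_left fun _ => ?_
        simp only [List.mem_map, List.mem_filter, decide_eq_true_eq]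
        constructor
        · exact fun h a ha => h _ ⟨a, ⟨hper a ha, ha⟩, rfl⟩
        · rintro h _ ⟨a, ⟨-, ha⟩, rfl⟩
          exact h a ha
      rw [hsplit]
      set K := agents.toFinset.filter (· ∈ periodicPts f) with hK
      have hKmem : ∀ a, a ∈ K ↔ a ∈ periodicPts f := by
        intro a
        rw [hK, Finset.mem_filter, List.mem_toFinset]
        exact ⟨fun h => h.2, fun h => ⟨hper a h, h⟩⟩
      have hset : (agents.filter (· ∉ periodicPts f)).toFinset = agents.toFinset \ K := by
        ext a
        simp only [List.mem_toFinset, List.mem_filter, decide_eq_true_eq, Finset.mem_sdiff, hKmem]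
      have hbest : ∀ b, ∀ c ∈ agents.toFinset, rk b (top b) ≤ rk b (x c) := by
        intro b c hc
        exact (htop b).2 _ ((hx _).2 (by simpa using hc))
      have key : (∀ a ∈ periodicPts f, x a = top a) →
          ((∀ a ∈ K, (x.trans own) a ∈ K) ∧ (∀ a ∈ K, Content rk x agents.toFinset a)) ∧
          ((∀ p ∈ TTCAux rk m (agents.filter (· ∉ periodicPts f))
            (objects.filter fun o => ∀ a ∈ agents, a ∈ periodicPts f → top a ≠ o) own,
            x p.1 = p.2) ↔ Clears rk x (x.trans own) (agents.toFinset \ K)) := by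
        intro hxt
        refine ⟨⟨fun a ha => ?_, fun a ha => ?_⟩, ?_⟩
        · rw [hKmem] at ha ⊢
          rw [Equiv.trans_apply, hxt a ha]
          exact hbij.mapsTo ha
        · rw [hKmem] at ha
          intro c hc
          rw [hxt a ha]
          exact hbest a c hc
        · rw [← hset]
          refine ih2 fun o => ?_
          rw [hmem, List.mem_filter, ← hx, decide_eq_true_eq]
          refine and_congr_right fun _ => not_congr ⟨?_, fun h => ⟨_, h, ?_⟩⟩
          · rintro ⟨a, ha, rfl⟩
            rwa [← hxt a ha, Equiv.symm_apply_apply]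
          · rw [← hxt _ h, Equiv.apply_symm_apply]
      constructor
      · rintro ⟨hxt, hrest⟩
        obtain ⟨⟨k1, k2⟩, k3⟩ := key hxt
        exact Clears.step (Finset.filter_subset _ _) k1 k2 (k3.1 hrest)
      · intro hcl
        have hfx : ∀ b, (x.trans own) (x.symm (top b)) = f b := fun b => by simp [hf]
        have hcont := hcl.content_of_cycle hinj x.injective (t := fun b => x.symm (top b)) (K := K)
          (Finset.filter_subset _ _) (fun b _ => by simpa using (hx _).1 (htop b).1)
          (fun b _ c hc => by simpa using hbest b c hc)
          (fun b hb => by rw [hfx, hKmem]; exact hbij.mapsTo ((hKmem b).1 hb))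
          (by
            intro a ha b hb h
            simp only [hfx] at h
            exact hbij.injOn ((hKmem a).1 ha) ((hKmem b).1 hb) h)
        have hxt : ∀ a ∈ periodicPts f, x a = top a := by
          intro a ha
          have h1 := hcont a ((hKmem a).2 ha) (x.symm (top a))
            (by simpa using (hx _).1 (htop a).1)
          rw [Equiv.apply_symm_apply] at h1
          exact hinj a (le_antisymm h1 (hbest a a (by simpa using hper a ha)))
        obtain ⟨⟨k1, k2⟩, k3⟩ := key hxt
        exact ⟨hxt, k3.2 (hcl.sdiff k1 k2)⟩

lemma TTCfun_eq_iff (hinj : ∀ a, Injective (rk a)) (ω x : Equiv.Perm (Fin n)) :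
    TTCfun rk ω = x ↔ x.trans ω.symm ∈ clearingPerms rk x Finset.univ := by
  obtain ⟨h1, h2⟩ := TTCAux_spec (rk := rk) hinj x ω.symm (m := n) (agents := List.finRange n)
    (objects := List.finRange n) (by simp) (List.nodup_finRange n) (by simp)
  rw [mem_clearingPerms, and_iff_right (by simp), ← List.toFinset_finRange, ← h2 (by simp),
    ← lookup_getD_eq_iff h1 ω]
  rfl

lemma card_TTCfun_eq (hinj : ∀ a, Injective (rk a)) (x : Equiv.Perm (Fin n)) :
    (Finset.univ.filter fun ω : Equiv.Perm (Fin n) => TTCfun rk ω = x).card =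
      (clearingPerms rk x Finset.univ).card := by
  refine Finset.card_nbij' (fun ω => x.trans ω.symm) (fun σ => σ.symm.trans x) ?_ ?_ ?_ ?_
  · intro ω hω
    simpa [TTCfun_eq_iff hinj] using hω
  · intro σ hσ
    simp only [Finset.coe_filter, Finset.mem_univ, true_and, Set.mem_ofPred_eq,
      TTCfun_eq_iff hinj]
    have : x.trans (σ.symm.trans x).symm = σ := by
      ext a
      simp
    rwa [this]
  · intro ω _
    ext a
    simp
  · intro σ _
    ext a
    simp

end TopTradingCycles

lemma card_crawlWords_eq_card_clearingPerms {rk : Fin n → Fin n → Fin n}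
    (hinj : ∀ a, Function.Injective (rk a)) (huni : Unimodal rk) {x : Fin n → Fin n}
    (hx : Function.Injective x) {S : Finset (Fin n)} {O : List (Fin n)}
    (hO : O.Pairwise (· < ·)) (hOS : O.toFinset = S.image x) :
    (crawlWords rk x S O).card = (clearingPerms rk x S).card := by
  classical
  induction S using Finset.strongInduction generalizing O with
  | H S ih =>
    rcases S.eq_empty_or_nonempty with rfl | hS
    · obtain rfl : O = [] := by simpa using hOS
      rw [card_crawlWords_empty, card_clearingPerms_empty]
    · rw [card_crawlWords hinj huni hO hOS hx hS, card_clearingPerms hS]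
      refine Finset.sum_congr rfl fun b hb => ?_
      refine ih _ (Finset.erase_ssubset (Finset.mem_filter.1 hb).1)
        (hO.sublist List.erase_sublist) ?_
      rw [Finset.image_erase hx, ← hOS]
      ext o
      simp [hO.nodup.mem_erase_iff]

end

/-- the crawler from random endowments equals the core (TTC) from random
endowments: for every allocation `x`, the number of endowment profiles `ω` with
`CR(P,ω) = x` equals the number of endowment profiles `ω` with `TTC^ω(P) = x`. -/
theorem crawler_from_random_endowments_eq_core_from_random_endowments {n : ℕ} (hn : 1 ≤ n)
    (P : Fin n → Equiv.Perm (Fin n)) (hP : SinglePeaked P) (x : Equiv.Perm (Fin n)) :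
    (Finset.univ.filter fun ω : Equiv.Perm (Fin n) => CRfun (fun j => ⇑(P j)) ⇑ω = ⇑x).card =
      (Finset.univ.filter fun ω : Equiv.Perm (Fin n) => TTCfun (fun j => ⇑(P j)) ω = ⇑x).card := by
  have hinj : ∀ a, Function.Injective ((fun j => ⇑(P j)) a) := fun a => (P a).injective
  have hO : (List.finRange n).Pairwise (· < ·) := List.pairwise_lt_finRange n
  have h := card_crawlWords_eq_card_clearingPerms hinj hP.unimodal x.injective
    (S := Finset.univ) hO (by
      rw [List.toFinset_finRange, Finset.image_univ_of_surjective x.surjective])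
  rw [← card_CRfun_eq, ← card_TTCfun_eq hinj] at h
  convert h
end

section
/- For every preference profile P that is single-peaked with respect to ≺ and every endowment profile ω, applying the crawler to the endowment profile given by the Top Trading Cycles allocation returns that allocation itself: CR(P, TTC^ω(P)) = TTC^ω(P). -/
/-! ### Minimizers on lists -/

theorem argmin_getD_mem_and_le {α β : Type*} [LinearOrder β] (f : α → β) {l : List α}
    (hl : l ≠ []) (d : α) :
    (l.argmin f).getD d ∈ l ∧ ∀ o ∈ l, f ((l.argmin f).getD d) ≤ f o := by
  cases h : l.argmin f with
  | none => exact absurd (List.argmin_eq_none.1 h) hl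
  | some m => exact ⟨List.argmin_mem h, fun o ho => List.le_of_mem_argmin ho h⟩

theorem List.lookup_eq_none_or_mem {α β : Type*} [BEq α] [LawfulBEq α] (L : List (α × β)) (i : α) :
    (L.lookup i = none ∧ i ∉ L.map Prod.fst) ∨ ∃ v, L.lookup i = some v ∧ (i, v) ∈ L := by
  induction L with
  | nil => simp
  | cons p L ih =>
    obtain ⟨a, b⟩ := p
    rw [List.lookup_cons]
    by_cases h : i = a
    · subst h
      simp
    · have h' : (i == a) = false := by simpa using h
      rw [h']
      rcases ih with ⟨h1, h2⟩ | ⟨v, h1, h2⟩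
      · exact Or.inl ⟨h1, by simpa [h] using h2⟩
      · exact Or.inr ⟨v, h1, List.mem_cons_of_mem _ h2⟩

/-! ### The crawler -/

/-- The crawler stops at an agent `a` who prefers his object to the next one, having only passed
agents who do not; along the passed agents `τ` is monotone. -/
theorem findIdx2_split {n : ℕ} (rk : Fin n → Fin n → Fin n) (x : Fin n → Fin n) (τ : Fin n → ℕ)
    (hτ : ∀ i j, rk i (x j) ≤ rk i (x i) → τ j ≤ τ i) :
    ∀ l : List (Fin n), l ≠ [] → ∃ pre a post, l = pre ++ a :: post ∧
      findIdx2 rk l (l.map x) = pre.length ∧ (∀ b ∈ pre, τ a ≤ τ b) ∧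
      ∀ c ∈ post.head?, rk a (x a) < rk a (x c)
  | [], h => absurd rfl h
  | [a], _ => ⟨[], a, [], by simp [findIdx2]⟩
  | a :: b :: l, _ => by
    by_cases h : rk a (x a) < rk a (x b)
    · exact ⟨[], a, b :: l, by simp [findIdx2, h]⟩
    · obtain ⟨pre, c, post, h1, h2, h3, h4⟩ := findIdx2_split rk x τ hτ (b :: l) (by simp)
      refine ⟨a :: pre, c, post, by simp [h1], ?_, ?_, h4⟩
      · rw [List.length_cons, ← h2]
        simp [findIdx2, h]
      · have hb : τ c ≤ τ b := by
          cases pre with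
          | nil => simp at h1; rw [h1.1]
          | cons d pre =>
            simp at h1
            exact h3 b (by simp [h1.1])
        intro d hd
        rcases List.mem_cons.1 hd with rfl | hd
        · exact hb.trans (hτ _ _ (not_lt.1 h))
        · exact h3 d hd

theorem SinglePeaked.lt_of_lt {n : ℕ} {P : Fin n → Equiv.Perm (Fin n)} (hP : SinglePeaked P)
    {i u v w : Fin n} (huv : u < v) (hvw : v ≤ w) (h : P i u < P i v) : P i u < P i w := by
  obtain ⟨p, hp⟩ := hP i
  rcases le_or_gt v p with hv | hv
  · exact absurd (hp v u (Or.inl ⟨huv, hv⟩)) h.not_gt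
  · rcases hvw.eq_or_lt with rfl | hvw
    · exact h
    · exact h.trans (hp v w (Or.inr ⟨hv.le, hvw⟩))

/-- If envy is acyclic at `x`, as witnessed by `τ`, then the crawler started at `x` assigns to
every agent his own endowment. -/
theorem crawlAux_eq_of_acyclic_envy {n : ℕ} {P : Fin n → Equiv.Perm (Fin n)}
    (hP : SinglePeaked P) (x : Fin n → Fin n) (hx : Function.Injective x) (τ : Fin n → ℕ)
    (hτ : ∀ i j, P i (x j) < P i (x i) → τ j < τ i) :
    ∀ (fuel : ℕ) (l : List (Fin n)), (l.map x).Pairwise (· < ·) →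
      ∀ p ∈ crawlAux (fun j => ⇑(P j)) fuel l (l.map x), p.2 = x p.1 := by
  have hτ' : ∀ i j, P i (x j) ≤ P i (x i) → τ j ≤ τ i := fun i j h => by
    rcases h.lt_or_eq with h | h
    · exact (hτ i j h).le
    · rw [hx ((P i).injective h)]
  intro fuel
  induction fuel with
  | zero => simp [crawlAux]
  | succ fuel ih =>
    intro l hl
    rcases l with _ | ⟨a0, l0⟩
    · simp [crawlAux]
    obtain ⟨pre, a, post, h1, h2, h3, h4⟩ :=
      findIdx2_split (fun j => ⇑(P j)) x τ hτ' (a0 :: l0) (by simp)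
    have hargmin := argmin_getD_mem_and_le (P a) (l := (a0 :: l0).map x) (by simp) (x a0)
    simp only [List.map_cons, crawlAux] at h2 hargmin ⊢
    rw [h2]
    rw [h1] at hl
    rw [← List.map_cons, h1] at hargmin ⊢
    set ostar := (List.argmin (P a) ((pre ++ a :: post).map x)).getD (x a0) with ho
    have hnodup : ((pre ++ a :: post).map x).Nodup := hl.imp (fun h => ne_of_lt h)
    have hostar : ostar = x a := by
      have hle : P a ostar ≤ P a (x a) := hargmin.2 _ (by simp)
      rcases hle.eq_or_lt with h | hlt
      · exact (P a).injective h
      exfalso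
      obtain ⟨j, hj, hjo⟩ := List.mem_map.1 hargmin.1
      rw [← hjo] at hlt
      rcases List.mem_append.1 hj with hj | hj
      · exact absurd (hτ a j hlt) (h3 j hj).not_gt
      rcases List.mem_cons.1 hj with rfl | hj
      · exact lt_irrefl _ hlt
      cases post with
      | nil => simp at hj
      | cons c post =>
        simp only [List.map_append, List.map_cons, List.pairwise_append, List.pairwise_cons] at hl
        have hac : x a < x c := hl.2.1.1 _ (by simp)
        have hcj : x c ≤ x j := by
          rcases List.mem_cons.1 hj with rfl | hj
          · exact le_rfl
          · exact (hl.2.1.2.1 _ (List.mem_map_of_mem hj)).le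
        exact absurd (hP.lt_of_lt hac hcj (h4 c (by simp))) hlt.not_gt
    have hget : (pre ++ a :: post).getD pre.length a0 = a := by simp
    have hagents : (pre ++ a :: post).eraseIdx pre.length = pre ++ post := by
      rw [List.eraseIdx_append_of_length_le le_rfl]; simp
    have hobjects : ((pre ++ a :: post).map x).erase (x a) = (pre ++ post).map x := by
      have : x a ∉ pre.map x := by
        intro hmem
        rw [List.map_append, List.map_cons, List.nodup_append] at hnodup
        exact hnodup.2.2 _ hmem _ (by simp) rfl
      rw [List.map_append, List.erase_append_right _ this]
      simp
    rw [hget, ← ho, hostar, hagents, hobjects]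
    intro p hp
    rcases List.mem_cons.1 hp with rfl | hp
    · rfl
    · refine ih _ (hl.sublist ?_) p hp
      exact ((List.Sublist.refl pre).append (List.sublist_cons_self a post)).map x

theorem map_ownersList {n : ℕ} {x : Fin n → Fin n} (hx : Function.Surjective x) :
    (ownersList x).map x = List.finRange n := by
  have key : ∀ l : List (Fin n),
      (l.filterMap fun o => (List.finRange n).find? fun a => x a == o).map x = l := by
    intro l
    induction l with
    | nil => rfl
    | cons o l ih =>
      cases h : (List.finRange n).find? fun a => x a == o with
      | none =>
        obtain ⟨a, ha⟩ := hx o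
        have := List.find?_eq_none.1 h a (List.mem_finRange a)
        simp [ha] at this
      | some a =>
        have := List.find?_some h
        rw [List.filterMap_cons_some (b := a) (by exact h), List.map_cons, ih]
        simpa using this
  exact key _

theorem CRfun_eq_of_acyclic_envy {n : ℕ} {P : Fin n → Equiv.Perm (Fin n)}
    (hP : SinglePeaked P) (x : Fin n → Fin n) (hx : Function.Injective x) (τ : Fin n → ℕ)
    (hτ : ∀ i j, P i (x j) < P i (x i) → τ j < τ i) :
    CRfun (fun j => ⇑(P j)) x = x := by
  have hown := map_ownersList (Finite.surjective_of_injective hx)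
  have key := crawlAux_eq_of_acyclic_envy hP x hx τ hτ n (ownersList x)
    (by rw [hown]; exact List.pairwise_lt_finRange n)
  rw [hown] at key
  funext i
  unfold CRfun
  rcases List.lookup_eq_none_or_mem
    (crawlAux (fun j => ⇑(P j)) n (ownersList x) (List.finRange n)) i with ⟨h, -⟩ | ⟨v, h, hv⟩
  · rw [h]; rfl
  · rw [h]; exact key _ hv

/-! ### Top trading cycles -/

/-- A self-map of a finite list has a periodic point of period at most the length of the list. -/
theorem exists_iterate_eq_of_mapsTo_list {α : Type*} [DecidableEq α] (f : α → α) (l : List α)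
    (hl : l ≠ []) (hf : ∀ a ∈ l, f a ∈ l) : ∃ b ∈ l, ∃ k < l.length, f^[k + 1] b = b := by
  obtain ⟨a, ha⟩ := List.exists_mem_of_ne_nil l hl
  have hiter : ∀ k, f^[k] a ∈ l := fun k => by
    induction k with
    | zero => exact ha
    | succ k ih => rw [Function.iterate_succ_apply']; exact hf _ ih
  obtain ⟨i, hi, j, hj, hij, heq⟩ := Finset.exists_ne_map_eq_of_card_lt_of_maps_to
    (s := Finset.range (l.length + 1)) (t := l.toFinset) (f := fun k => f^[k] a)
    (by rw [Finset.card_range]; exact Nat.lt_succ_of_le (List.toFinset_card_le l))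
    (fun k _ => by simpa using hiter k)
  wlog hlt : i < j generalizing i j
  · exact this j hj i hi hij.symm heq.symm (by omega)
  simp only [Finset.mem_range] at hi hj
  refine ⟨f^[i] a, hiter i, j - i - 1, by omega, ?_⟩
  rw [← Function.iterate_add_apply, show j - i - 1 + 1 + i = j by omega]
  exact heq.symm

/-- The list of assignments made by top trading cycles: every agent appears once, objects are not
repeated, and nobody prefers an object assigned later to his own. -/
theorem TTCAux_spec_s7 {n : ℕ} (rk : Fin n → Fin n → Fin n) (own : Equiv.Perm (Fin n)) :
    ∀ (fuel : ℕ) (agents objects : List (Fin n)), agents.length ≤ fuel →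
      (∀ o, o ∈ objects ↔ own o ∈ agents) →
      (∀ p ∈ TTCAux rk fuel agents objects own, p.2 ∈ objects) ∧
      (∀ a ∈ agents, a ∈ (TTCAux rk fuel agents objects own).map Prod.fst) ∧
      (agents.Nodup → ((TTCAux rk fuel agents objects own).map Prod.snd).Nodup) ∧
      (TTCAux rk fuel agents objects own).Pairwise fun p q => rk p.1 p.2 ≤ rk p.1 q.2 := by
  intro fuel
  induction fuel with
  | zero =>
    intro agents objects hlen _
    have : agents = [] := List.length_eq_zero_iff.1 (by omega)
    simp [TTCAux, this]
  | succ fuel ih =>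
    intro agents objects hlen hown
    rcases hag : agents with _ | ⟨a0, l0⟩
    · simp [TTCAux]
    simp only [TTCAux]
    rw [← hag]
    have hobj : objects ≠ [] := by
      have : own.symm a0 ∈ objects := (hown _).2 (by simp [hag])
      exact List.ne_nil_of_mem this
    set top : Fin n → Fin n := fun a => (objects.argmin (rk a)).getD a0 with htop
    have top_mem : ∀ a, top a ∈ objects := fun a => (argmin_getD_mem_and_le (rk a) hobj a0).1
    have top_le : ∀ a, ∀ o ∈ objects, rk a (top a) ≤ rk a o :=
      fun a => (argmin_getD_mem_and_le (rk a) hobj a0).2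
    set ptr : Fin n → Fin n := fun a => own (top a) with hptr
    set onCyc : Fin n → Bool := fun a =>
      (List.range agents.length).any fun k => ptr^[k + 1] a == a with honCyc
    have onCyc_iff : ∀ a, onCyc a = true ↔ ∃ k < agents.length, ptr^[k + 1] a = a := by
      intro a; simp [honCyc]
    have ptr_mem : ∀ a, ptr a ∈ agents := fun a => (hown _).1 (top_mem a)
    have iter_mem : ∀ k, ∀ a ∈ agents, ptr^[k] a ∈ agents := fun k a ha => by
      cases k with
      | zero => exact ha
      | succ k => rw [Function.iterate_succ_apply']; exact ptr_mem _
    have onCyc_iter : ∀ m a, onCyc a = true → onCyc (ptr^[m] a) = true := by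
      intro m a ha
      obtain ⟨k, hk, h⟩ := (onCyc_iff a).1 ha
      refine (onCyc_iff _).2 ⟨k, hk, ?_⟩
      rw [← Function.iterate_add_apply, Nat.add_comm, Function.iterate_add_apply, h]
    set cyc := agents.filter onCyc with hcyc
    set agents' := agents.filter fun a => !onCyc a with hagents'
    set objects' := objects.filter fun o => !((cyc.map top).contains o) with hobjects'
    have mem_objects' : ∀ o, o ∈ objects' ↔ o ∈ objects ∧ o ∉ cyc.map top := by
      intro o; simp [hobjects']
    have hlen' : agents'.length ≤ fuel := by
      obtain ⟨b, hb, hcb⟩ := exists_iterate_eq_of_mapsTo_list ptr agents (by simp [hag])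
        fun a _ => ptr_mem a
      have : agents'.length < agents.length := by
        refine List.length_filter_lt_length_iff_exists.2 ⟨b, hb, ?_⟩
        simp [(onCyc_iff b).2 hcb]
      omega
    have hown' : ∀ o, o ∈ objects' ↔ own o ∈ agents' := by
      intro o
      rw [mem_objects', hown, hagents', List.mem_filter, Bool.not_eq_true']
      refine and_congr_right fun ho => ⟨fun h => ?_, fun h hmem => ?_⟩
      · rw [← Bool.not_eq_true]
        intro hc
        obtain ⟨k, hk, hkk⟩ := (onCyc_iff _).1 hc
        refine h (List.mem_map.2 ⟨ptr^[k] (own o), ?_, ?_⟩)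
        · exact List.mem_filter.2 ⟨iter_mem k _ ho, onCyc_iter k _ hc⟩
        · rw [Function.iterate_succ_apply'] at hkk
          exact own.injective hkk
      · obtain ⟨a, ha, rfl⟩ := List.mem_map.1 hmem
        have := onCyc_iter 1 a (List.mem_filter.1 ha).2
        rw [Function.iterate_one] at this
        exact absurd (this.symm.trans h) (by simp)
    obtain ⟨ih1, ih2, ih3, ih4⟩ := ih agents' objects' hlen' hown'
    set L := TTCAux rk fuel agents' objects' own with hL
    have hLsub : ∀ p ∈ L, p.2 ∈ objects := fun p hp => ((mem_objects' _).1 (ih1 p hp)).1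
    refine ⟨?_, ?_, ?_, ?_⟩
    · intro p hp
      rcases List.mem_append.1 hp with hp | hp
      · obtain ⟨a, -, rfl⟩ := List.mem_map.1 hp
        exact top_mem a
      · exact hLsub p hp
    · intro a ha
      rw [List.map_append, List.mem_append]
      by_cases hc : onCyc a = true
      · left
        simp [hcyc, ha, hc]
      · exact Or.inr (ih2 a (List.mem_filter.2 ⟨ha, by simpa using hc⟩))
    · intro hnd
      rw [List.map_append, List.map_map, List.nodup_append]
      refine ⟨?_, ih3 (hnd.filter _), ?_⟩
      · refine List.Nodup.map_on ?_ (hnd.filter _)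
        intro a ha b hb hab
        have hper : ∀ c ∈ cyc, c ∈ Function.periodicPts ptr := by
          intro c hc
          obtain ⟨k, -, h⟩ := (onCyc_iff c).1 (List.mem_filter.1 hc).2
          exact Function.mk_mem_periodicPts (Nat.succ_pos k) h
        exact (Function.bijOn_periodicPts ptr).injOn (hper a ha) (hper b hb) (congrArg own hab)
      · intro o ho o' ho' heq
        obtain ⟨p, hp, rfl⟩ := List.mem_map.1 ho'
        exact ((mem_objects' _).1 (ih1 p hp)).2 (heq ▸ ho)
    · rw [List.pairwise_append]
      refine ⟨?_, ih4, ?_⟩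
      · rw [List.pairwise_map]
        exact List.pairwise_of_forall fun a b => top_le a _ (top_mem b)
      · intro p hp q hq
        obtain ⟨a, -, rfl⟩ := List.mem_map.1 hp
        exact top_le a _ (hLsub q hq)

/-- The top trading cycles allocation is injective, and envy at it is acyclic: an agent only
envies agents assigned before him. -/
theorem TTCfun_injective_and_acyclic_envy {n : ℕ} (rk : Fin n → Fin n → Fin n)
    (ω : Equiv.Perm (Fin n)) :
    Function.Injective (TTCfun rk ω) ∧ ∃ τ : Fin n → ℕ, ∀ i j,
      rk i (TTCfun rk ω j) < rk i (TTCfun rk ω i) → τ j < τ i := by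
  obtain ⟨-, hmem, hnd, hpw⟩ := TTCAux_spec_s7 rk ω.symm n (List.finRange n) (List.finRange n)
    (by simp) (by simp)
  set L := TTCAux rk n (List.finRange n) (List.finRange n) ω.symm with hL
  have hx : ∀ i, (i, TTCfun rk ω i) ∈ L := by
    intro i
    unfold TTCfun
    rcases List.lookup_eq_none_or_mem L i with ⟨-, h⟩ | ⟨v, h, hv⟩
    · exact absurd (hmem i (List.mem_finRange i)) h
    · rw [← hL, h]; exact hv
  refine ⟨fun i j hij => ?_, fun i => L.idxOf (i, TTCfun rk ω i), fun i j hij => ?_⟩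
  · exact congrArg Prod.fst
      (List.inj_on_of_nodup_map (hnd (List.nodup_finRange n)) (hx i) (hx j) hij)
  · by_contra hle
    have hi := List.idxOf_lt_length_of_mem (hx i)
    have hj := List.idxOf_lt_length_of_mem (hx j)
    rcases (not_lt.1 hle).eq_or_lt with h | h
    · have := congrArg Prod.fst ((List.idxOf_inj (hx i)).1 h)
      simp only at this
      subst this
      exact lt_irrefl _ hij
    · have := List.pairwise_iff_getElem.1 hpw _ _ hi hj h
      simp only [List.getElem_idxOf] at this
      exact absurd hij this.not_gt

/-- applying the crawler to the endowment profile given by the TTC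
allocation returns that allocation itself: `CR(P, TTC^ω(P)) = TTC^ω(P)`. -/
theorem crawler_fixes_ttc_allocation {n : ℕ} (hn : 1 ≤ n)
    (P : Fin n → Equiv.Perm (Fin n)) (hP : SinglePeaked P) (ω : Equiv.Perm (Fin n)) :
    CRfun (fun j => ⇑(P j)) (TTCfun (fun j => ⇑(P j)) ω) = TTCfun (fun j => ⇑(P j)) ω := by
  obtain ⟨hx, τ, hτ⟩ := TTCfun_injective_and_acyclic_envy (fun j => ⇑(P j)) ω
  exact CRfun_eq_of_acyclic_envy hP _ hx τ hτ
end

section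
/- For every preference profile P that is single-peaked with respect to ≺ and every endowment profile ω that is itself Pareto efficient at P, the crawler returns the endowments unchanged: CR(P,ω) = ω. -/
/-- The first index selected by `findIdx2` splits the object list at an object whose owner prefers
it to the next one, while every earlier owner weakly prefers the next object to their own. -/
theorem findIdx2_split_s8 {n : ℕ} (rk : Fin n → Fin n → Fin n) (f : Fin n → Fin n) :
    ∀ L : List (Fin n), L ≠ [] → ∃ A o B, L = A ++ o :: B ∧
      findIdx2 rk (L.map f) L = A.length ∧
      (A ++ [o]).IsChain (fun a b => rk (f a) b ≤ rk (f a) a) ∧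
      ∀ b ∈ B.head?, rk (f o) o < rk (f o) b
  | [], h => absurd rfl h
  | [o], _ => ⟨[], o, [], by simp [findIdx2]⟩
  | o₁ :: o₂ :: os, _ => by
    by_cases h : rk (f o₁) o₁ < rk (f o₁) o₂
    · exact ⟨[], o₁, o₂ :: os, by simp [findIdx2, h]⟩
    · obtain ⟨A, o, B, hL, hidx, hchain, hB⟩ :=
        findIdx2_split_s8 rk f (o₂ :: os) (List.cons_ne_nil _ _)
      refine ⟨o₁ :: A, o, B, by rw [hL, List.cons_append], ?_, ?_, hB⟩
      · rw [List.map_cons] at hidx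
        simp [findIdx2, h, hidx]
      · rw [List.cons_append, List.isChain_cons]
        refine ⟨fun b hb => ?_, hchain⟩
        have : b = o₂ := by cases A <;> simp_all
        exact this ▸ not_lt.mp h

/-- No owner at the end of a chain of weakly profitable right shifts strictly prefers the object
at the start of the chain, since trading along the cycle would be a Pareto improvement. -/
theorem ParetoEfficient.not_lt_of_isChain {n : ℕ} {P : Fin n → Equiv.Perm (Fin n)}
    {ω : Equiv.Perm (Fin n)} (hω : ParetoEfficient P ω) {o o' : Fin n} {B : List (Fin n)}
    (hnd : (o' :: B ++ [o]).Nodup)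
    (hchain : (o' :: B ++ [o]).IsChain
      (fun a b => P (ω.symm a) b ≤ P (ω.symm a) a)) :
    ¬ P (ω.symm o) o' < P (ω.symm o) o := by
  intro hlt
  have hlast : (o' :: B ++ [o]).formPerm o = o' := by simp
  have himp (b : Fin n) : P (ω.symm b) ((o' :: B ++ [o]).formPerm b) ≤ P (ω.symm b) b := by
    by_cases hb : b ∈ o' :: B ++ [o]
    · obtain ⟨k, hk, rfl⟩ := List.getElem_of_mem hb
      by_cases hk' : k + 1 < (o' :: B ++ [o]).length
      · rw [List.formPerm_apply_lt_getElem _ hnd _ hk']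
        exact List.isChain_iff_getElem.mp hchain k hk'
      · have : (o' :: B ++ [o])[k] = o := by
          have : k = (o' :: B).length := by simp at hk hk' ⊢; omega
          subst this
          simp
        rw [this, hlast]
        exact hlt.le
    · rw [List.formPerm_apply_of_notMem hb]
  exact hω ⟨ω.trans (o' :: B ++ [o]).formPerm, fun i => by simpa using himp (ω i), ω.symm o,
    by simpa [hlast] using hlt⟩

/-- In a list of objects increasing along the order, an agent with single-peaked preferences who
prefers an object to its successor prefers it to every later object. -/
theorem SinglePeaked.lt_of_lt_head {n : ℕ} {P : Fin n → Equiv.Perm (Fin n)}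
    (hP : SinglePeaked P) {i o : Fin n} {B : List (Fin n)} (hB : (o :: B).Pairwise (· < ·))
    (hhead : ∀ b ∈ B.head?, P i o < P i b) {c : Fin n} (hc : c ∈ B) : P i o < P i c := by
  obtain ⟨p, hp⟩ := hP i
  cases B with
  | nil => simp at hc
  | cons b B =>
    have hob : P i o < P i b := hhead b (by simp)
    rcases List.mem_cons.mp hc with rfl | hc
    · exact hob
    · simp only [List.pairwise_cons] at hB
      have hpb : p ≤ b := by
        by_contra! h
        exact lt_asymm hob (hp b o (.inl ⟨hB.1 b (by simp), h.le⟩))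
      exact hob.trans (hp b c (.inr ⟨hpb, hB.2.1 c hc⟩))

/-- If the current ownership agrees with a Pareto efficient endowment, the crawler only ever
assigns agents their endowments. -/
theorem eq_of_mem_crawlAux {n : ℕ} {P : Fin n → Equiv.Perm (Fin n)} (hP : SinglePeaked P)
    {ω : Equiv.Perm (Fin n)} (hω : ParetoEfficient P ω) (fuel : ℕ) :
    ∀ L : List (Fin n), L.Pairwise (· < ·) →
      ∀ q ∈ crawlAux (fun j => P j) fuel (L.map ω.symm) L, q.2 = ω q.1 := by
  induction fuel with
  | zero => simp [crawlAux]
  | succ fuel ih =>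
    intro L hL q hq
    cases L with
    | nil => simp [crawlAux] at hq
    | cons o₀ os =>
      obtain ⟨A, o, B, hsplit, hidx, hchain, hhead⟩ :=
        findIdx2_split_s8 (fun j => P j) ω.symm (o₀ :: os) (List.cons_ne_nil _ _)
      rw [List.map_cons] at hq
      simp only [crawlAux] at hq
      rw [← List.map_cons, hidx, hsplit] at hq
      rw [hsplit] at hL
      have hnd : (A ++ o :: B).Nodup := hL.imp fun h => h.ne
      have hmin : (A ++ o :: B).argmin (P (ω.symm o)) = some o := by
        obtain ⟨m, hm⟩ := Option.ne_none_iff_exists'.mp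
          (mt (List.argmin_eq_none (f := P (ω.symm o))).mp (by simp : A ++ o :: B ≠ []))
        have hmo : P (ω.symm o) m ≤ P (ω.symm o) o := List.le_of_mem_argmin (by simp) hm
        rcases eq_or_ne m o with rfl | hne
        · exact hm
        have hlt := lt_of_le_of_ne hmo ((P (ω.symm o)).injective.ne hne)
        rcases List.mem_append.mp (List.argmin_mem hm) with h | h
        · obtain ⟨A₁, A₂, rfl⟩ := List.append_of_mem h
          refine absurd hlt (hω.not_lt_of_isChain (B := A₂) ?_ ?_)
          · refine hnd.sublist ?_
            simp
          · exact (List.append_assoc A₁ (m :: A₂) [o] ▸ hchain).right_of_append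
        · rcases List.mem_cons.mp h with rfl | h
          · exact absurd rfl hne
          · exact absurd hlt (hP.lt_of_lt_head (List.pairwise_append.mp hL).2.1 hhead h).asymm
      have hagent (d : Fin n) : ((A ++ o :: B).map ω.symm).getD A.length d = ω.symm o := by
        simp
      have hrest : (A ++ o :: B).erase o = A ++ B := by
        rw [List.erase_append_right _ (fun h => ?_), List.erase_cons_head]
        exact (List.nodup_append.mp hnd).2.2 o h o (by simp) rfl
      have hagents : ((A ++ o :: B).map ω.symm).eraseIdx A.length = (A ++ B).map ω.symm := by
        simp [List.eraseIdx_append_of_length_le]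
      rw [hagent, hmin, Option.getD_some, hrest, hagents] at hq
      rcases List.mem_cons.mp hq with rfl | hq
      · simp
      · exact ih _ (hL.sublist (by simp)) q hq

theorem ownersList_eq_map {n : ℕ} (ω : Equiv.Perm (Fin n)) :
    ownersList ω = (List.finRange n).map ω.symm := by
  rw [ownersList, ← List.filterMap_eq_map]
  congr 1
  funext o
  cases h : (List.finRange n).find? fun a => ω a == o with
  | none => exact absurd (List.find?_eq_none.mp h (ω.symm o) (List.mem_finRange _)) (by simp)
  | some a => simpa [Equiv.eq_symm_apply] using List.find?_some h

/-- if the endowment profile `ω` is itself Pareto efficient at `P`, the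
crawler returns the endowments unchanged: `CR(P,ω) = ω`. -/
theorem crawler_fixes_efficient_endowment {n : ℕ} (hn : 1 ≤ n)
    (P : Fin n → Equiv.Perm (Fin n)) (hP : SinglePeaked P) (ω : Equiv.Perm (Fin n))
    (hω : ParetoEfficient P ⇑ω) :
    CRfun (fun j => ⇑(P j)) ⇑ω = ⇑ω := by
  funext i
  rw [CRfun, ownersList_eq_map]
  cases h : (crawlAux (fun j => P j) n ((List.finRange n).map ω.symm)
      (List.finRange n)).lookup i with
  | none => rfl
  | some o =>
    obtain ⟨l₁, l₂, hl, -⟩ := List.lookup_eq_some_iff.mp h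
    exact eq_of_mem_crawlAux hP hω n _ (List.pairwise_lt_finRange n) (i, o) (by simp [hl])
end
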